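/- For every integer n ≥ 0 the following linear rank congruences modulo 11 hold, where in each line N_i = N(i,11,·) at the indicated argument. At 11n: N_2 − 5N_3 − 2N_4 + 6N_5 ≡ 0 (mod 11). At 11n+1: N_1 − 6N_2 + 4N_3 + 3N_4 − 2N_5 ≡ 0 (mod 11). At 11n+2: N_0 + 4N_2 − 6N_4 + N_5 ≡ 0 (mod 11). At 11n+3: N_0 + 3N_1 − N_2 + 2N_3 − N_4 − 4N_5 ≡ 0 (mod 11). At 11n+4: N_0 + 3N_1 − 2N_2 − 4N_3 + N_4 + N_5 ≡ 0 (mod 11). At 11n+5: N_0 − 5N_1 − N_2 + N_3 + 5N_4 − N_5 ≡ 0 (mod 11). At 11n+6: N_1 − 5N_2 − N_3 + N_4 + 4N_5 ≡ 0 (mod 11). At 11n+7: N_0 − 2N_1 − 2N_2 + 5N_3 + 2N_4 − 4N_5 ≡ 0 (mod 11). At 11n+8: N_0 + 5N_1 + 2N_2 + N_3 − 3N_4 − 6N_5 ≡ 0 (mod 11). At 11n+9: N_0 − 4N_1 + 3N_2 − N_3 − N_4 + 2N_5 ≡ 0 (mod 11). At 11n+10: N_0 − 6N_1 + N_4 +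 4N_5 ≡ 0 (mod 11). -/

import Mathlib

/-- `p n`: the number of partitions of `n`. -/
def partitionCount (n : ℕ) : ℕ := Fintype.card (Nat.Partition n)

/-- The rank of a partition: its largest part minus its number of parts
(the empty partition has rank 0). -/
def partitionRank {n : ℕ} (π : Nat.Partition n) : ℤ :=
  (π.parts.sup : ℤ) - (Multiset.card π.parts : ℤ)

/-- The crank of a partition `π`: if `π` has no parts equal to 1, it is the largest part;
otherwise it is (number of parts larger than the number of ones) − (number of ones). -/
def partitionCrank {n : ℕ} (π : Nat.Partition n) : ℤ :=
  if π.parts.count 1 = 0 then (π.parts.sup : ℤ)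
  else ((π.parts.filter fun x => π.parts.count 1 < x).card : ℤ) - (π.parts.count 1 : ℤ)

/-- `rankCount a r n` = `N(a,r,n)`: the number of partitions of `n` whose rank is
congruent to `a` modulo `r`. -/
def rankCount (a r : ℤ) (n : ℕ) : ℕ :=
  (Finset.univ.filter fun π : Nat.Partition n => partitionRank π % r = a % r).card

/-- `crankCount a n` = `M(a,11,n)`: for `n ≠ 1`, the number of partitions of `n` whose crank
is congruent to `a` modulo 11; at `n = 1` the standard convention `M(0,11,1) = −1`,
`M(1,11,1) = M(10,11,1) = 1`, and `M(a,11,1) = 0` otherwise. -/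
def crankCount (a : ℤ) (n : ℕ) : ℤ :=
  if n = 1 then
    if a % 11 = 0 then -1
    else if a % 11 = 1 ∨ a % 11 = 10 then 1
    else 0
  else ((Finset.univ.filter fun π : Nat.Partition n => partitionCrank π % 11 = a % 11).card : ℤ)

namespace Multiset

theorem sup_mem_of_ne_zero {s : Multiset ℕ} (h : s ≠ 0) : s.sup ∈ s := by
  induction s using Multiset.induction_on with
  | empty => exact absurd rfl h
  | cons a s ih =>
    rw [sup_cons]
    by_cases hs : s = 0
    · simp [hs]
    · rcases le_total a s.sup with h1 | h1
      · rw [sup_eq_right.2 h1]; exact mem_cons_of_mem (ih hs)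
      · rw [sup_eq_left.2 h1]; exact mem_cons_self _ _

theorem cons_erase_sup_filter {s : Multiset ℕ} (hs : ∀ i ∈ s, 0 < i) :
    (s.sup ::ₘ s.erase s.sup).filter (· ≠ 0) = s := by
  by_cases h : s = 0
  · subst h; simp
  · rw [cons_erase (sup_mem_of_ne_zero h)]
    exact filter_eq_self.2 fun i hi => (hs i hi).ne'

theorem sup_add_sum_erase (s : Multiset ℕ) : s.sup + (s.erase s.sup).sum = s.sum := by
  by_cases h : s = 0
  · subst h; simp
  · exact sum_erase (sup_mem_of_ne_zero h)

theorem sum_filter_ne_zero (s : Multiset ℕ) : (s.filter (· ≠ 0)).sum = s.sum := by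
  induction s using Multiset.induction_on with
  | empty => simp
  | cons a s ih => by_cases h : a = 0 <;> simp_all

theorem sum_map_pred_add_card {s : Multiset ℕ} (hs : ∀ i ∈ s, 0 < i) :
    (s.map (· - 1)).sum + card s = s.sum := by
  induction s using Multiset.induction_on with
  | empty => simp
  | cons a s ih =>
    have := ih fun i hi => hs i (mem_cons_of_mem hi)
    have := hs a (mem_cons_self _ _)
    simp only [map_cons, sum_cons, card_cons]
    omega

theorem map_succ_filter_pred {s : Multiset ℕ} (hs : ∀ i ∈ s, 0 < i) :
    ((s.map (· - 1)).filter (· ≠ 0)).map (· + 1) +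
      replicate (card s - card ((s.map (· - 1)).filter (· ≠ 0))) 1 = s := by
  induction s using Multiset.induction_on with
  | empty => simp
  | cons a s ih =>
    have ih := ih fun i hi => hs i (mem_cons_of_mem hi)
    have ha := hs a (mem_cons_self _ _)
    have hc : card ((s.map (· - 1)).filter (· ≠ 0)) ≤ card s := by
      simpa using card_le_card (filter_le (· ≠ 0) (s.map (· - 1)))
    by_cases h : a = 1
    · subst h
      simp only [map_cons, card_cons, le_refl, tsub_eq_zero_of_le, ne_eq, not_true_eq_false,
        not_false_eq_true, filter_cons_of_neg]
      rw [Nat.succ_sub hc, replicate_succ, add_cons]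
      exact congrArg _ ih
    · have h2 : a - 1 ≠ 0 := by omega
      rw [map_cons, filter_cons_of_pos (p := (· ≠ 0)) _ h2, map_cons, card_cons, card_cons,
        cons_add,
        Nat.add_sub_add_right]
      rw [Nat.sub_add_cancel ha]
      exact congrArg _ ih

/-- Dyson's map: remove the first column of a Ferrers diagram and insert a new part so that
the size becomes `N`. -/
def dyson (n N : ℕ) (s : Multiset ℕ) : Multiset ℕ :=
  ((card s + N - n) ::ₘ s.map (· - 1)).filter (· ≠ 0)

/-- The inverse of Dyson's map. -/
def dysonInv (n N : ℕ) (t : Multiset ℕ) : Multiset ℕ :=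
  (t.erase t.sup).map (· + 1) + replicate (t.sup + n - N - (card t - 1)) 1

variable {n N : ℕ} {s t : Multiset ℕ}

theorem sum_dyson (hs : ∀ i ∈ s, 0 < i) (hn : s.sum = n) (h : n ≤ card s + N) :
    (dyson n N s).sum = N := by
  have := sum_map_pred_add_card hs
  rw [dyson, sum_filter_ne_zero, sum_cons]
  omega

theorem sup_dyson (h : s.sup + n ≤ card s + N + 1) :
    (dyson n N s).sup = card s + N - n := by
  apply le_antisymm
  · refine Multiset.sup_le.2 fun i hi => ?_
    have hi := mem_of_mem_filter hi
    rw [mem_cons, mem_map] at hi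
    rcases hi with rfl | ⟨j, hj, rfl⟩
    · rfl
    · have := le_sup hj
      omega
  · by_cases h0 : card s + N - n = 0
    · omega
    · exact le_sup (mem_filter.2 ⟨mem_cons_self _ _, h0⟩)

theorem card_dyson_le : card (dyson n N s) ≤ card s + 1 := by
  simpa [dyson] using card_le_card (filter_le (· ≠ 0) ((card s + N - n) ::ₘ s.map (· - 1)))

theorem erase_sup_dyson (h : s.sup + n ≤ card s + N + 1) :
    (dyson n N s).erase (dyson n N s).sup = (s.map (· - 1)).filter (· ≠ 0) := by
  rw [sup_dyson h, dyson]
  by_cases h0 : card s + N - n = 0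
  · rw [filter_cons_of_neg _ (by simpa using h0), h0, erase_of_notMem]
    simp
  · rw [filter_cons_of_pos (p := (· ≠ 0)) _ h0, erase_cons_head]

theorem card_erase_sup (s : Multiset ℕ) : card (s.erase s.sup) = card s - 1 := by
  by_cases h : s = 0
  · subst h; simp
  · exact card_erase_of_mem (sup_mem_of_ne_zero h)

theorem dysonInv_dyson (hs : ∀ i ∈ s, 0 < i) (hN : n ≤ card s + N)
    (h : s.sup + n ≤ card s + N + 1) : dysonInv n N (dyson n N s) = s := by
  rw [dysonInv, ← card_erase_sup, erase_sup_dyson h, sup_dyson h]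
  have : card s + N - n + n - N = card s := by omega
  rw [this]
  exact map_succ_filter_pred hs

theorem card_dysonInv (h : N + card t ≤ t.sup + n + 1) (hN : N ≤ t.sup + n) :
    card (dysonInv n N t) = t.sup + n - N := by
  rw [dysonInv, card_add, card_map, card_replicate, card_erase_sup]
  omega

theorem sum_dysonInv (hN : t.sum = N) (h : N + card t ≤ t.sup + n + 1) (h' : N ≤ t.sup + n) :
    (dysonInv n N t).sum = n := by
  have h1 := sup_add_sum_erase t
  have h2 := card_erase_sup t
  rw [dysonInv, sum_add, sum_map_add, map_id', sum_replicate, map_const', sum_replicate, h2]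
  simp only [smul_eq_mul, mul_one]
  omega

theorem sup_dysonInv_le : (dysonInv n N t).sup ≤ t.sup + 1 := by
  refine Multiset.sup_le.2 fun i hi => ?_
  rw [dysonInv, mem_add, mem_map] at hi
  rcases hi with ⟨j, hj, rfl⟩ | hi
  · have := le_sup (mem_of_mem_erase hj)
    omega
  · rw [eq_of_mem_replicate hi]; omega

theorem pos_of_mem_dysonInv {i : ℕ} (hi : i ∈ dysonInv n N t) : 0 < i := by
  rw [dysonInv, mem_add, mem_map] at hi
  rcases hi with ⟨j, hj, rfl⟩ | hi
  · omega
  · rw [eq_of_mem_replicate hi]; omega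

theorem dyson_dysonInv (ht : ∀ i ∈ t, 0 < i) (h : N + card t ≤ t.sup + n + 1)
    (h' : N ≤ t.sup + n) : dyson n N (dysonInv n N t) = t := by
  have h1 : card (dysonInv n N t) + N - n = t.sup := by
    rw [card_dysonInv h h']; omega
  rw [dyson, h1, dysonInv, map_add, map_map, map_replicate]
  conv_rhs => rw [← cons_erase_sup_filter ht]
  rw [← cons_add, filter_add]
  simpa using fun a ha => eq_of_mem_replicate ha

end Multiset

theorem card_le_sum_of_pos {s : Multiset ℕ} (hs : ∀ i ∈ s, 0 < i) : s.card ≤ s.sum := by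
  have := Multiset.sum_map_pred_add_card hs
  omega

theorem card_add_sup_le {s : Multiset ℕ} (hs : ∀ i ∈ s, 0 < i) :
    s.card + s.sup ≤ s.sum + 1 := by
  have h1 := Multiset.sup_add_sum_erase s
  have h2 := card_le_sum_of_pos (s := s.erase s.sup) fun i hi => hs i (Multiset.mem_of_mem_erase hi)
  rw [Multiset.card_erase_sup] at h2
  omega

theorem Nat.Partition.parts_ne_zero {n : ℕ} (hn : n ≠ 0) (π : n.Partition) :
    π.parts ≠ 0 := by
  intro h
  have := π.parts_sum
  rw [h] at this
  exact hn (by simpa using this.symm)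

/-- Dyson's symmetry: partitions of `n` of rank at most `N - n + 1` are equinumerous with
partitions of `N` of rank at least `N - n - 1`. -/
theorem card_partitionRank_le_eq_card_le_partitionRank (n N : ℕ) :
    (Finset.univ.filter fun π : n.Partition => partitionRank π ≤ N - n + 1).card =
      (Finset.univ.filter fun π : N.Partition => (N : ℤ) - n - 1 ≤ partitionRank π).card := by
  have key : ∀ π : n.Partition, partitionRank π ≤ N - n + 1 →
      n ≤ π.parts.card + N ∧ π.parts.sup + n ≤ π.parts.card + N + 1 := by
    intro π h
    rw [partitionRank] at h
    rcases eq_or_ne n 0 with rfl | hn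
    · exact ⟨by omega, by omega⟩
    · have := π.parts_pos (Multiset.sup_mem_of_ne_zero (π.parts_ne_zero hn))
      exact ⟨by omega, by omega⟩
  have key' : ∀ π : N.Partition, (N : ℤ) - n - 1 ≤ partitionRank π →
      N + π.parts.card ≤ π.parts.sup + n + 1 ∧ N ≤ π.parts.sup + n := by
    intro π h
    rw [partitionRank] at h
    refine ⟨by omega, ?_⟩
    rcases eq_or_ne N 0 with rfl | hn
    · omega
    · have := Multiset.card_pos.2 (π.parts_ne_zero hn)
      omega
  refine Finset.card_bij'
    (fun π hπ => ⟨Multiset.dyson n N π.parts, fun hi => (Multiset.of_mem_filter hi).bot_lt,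
      Multiset.sum_dyson (fun i hi => π.parts_pos hi) π.parts_sum
        (key π (Finset.mem_filter.1 hπ).2).1⟩)
    (fun π hπ => ⟨Multiset.dysonInv n N π.parts, Multiset.pos_of_mem_dysonInv,
      Multiset.sum_dysonInv π.parts_sum (key' π (Finset.mem_filter.1 hπ).2).1
        (key' π (Finset.mem_filter.1 hπ).2).2⟩) ?_ ?_ ?_ ?_
  · intro π hπ
    have h := key π (Finset.mem_filter.1 hπ).2
    refine Finset.mem_filter.2 ⟨Finset.mem_univ _, ?_⟩
    have h1 := Multiset.sup_dyson h.2
    have h2 := Multiset.card_dyson_le (n := n) (N := N) (s := π.parts)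
    simp only [partitionRank]
    omega
  · intro π hπ
    have h := key' π (Finset.mem_filter.1 hπ).2
    refine Finset.mem_filter.2 ⟨Finset.mem_univ _, ?_⟩
    have h1 := Multiset.card_dysonInv h.1 h.2
    have h2 := Multiset.sup_dysonInv_le (n := n) (N := N) (t := π.parts)
    simp only [partitionRank]
    omega
  · intro π hπ
    have h := key π (Finset.mem_filter.1 hπ).2
    exact Nat.Partition.ext (Multiset.dysonInv_dyson (fun i hi => π.parts_pos hi) h.1 h.2)
  · intro π hπ
    have h := key' π (Finset.mem_filter.1 hπ).2
    exact Nat.Partition.ext (Multiset.dyson_dysonInv (fun i hi => π.parts_pos hi) h.1 h.2)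

/-- The number of partitions of `k` of rank at most `m` (zero for negative `k`). -/
def rankLeCount (m k : ℤ) : ℤ :=
  if 0 ≤ k then
    ((Finset.univ.filter fun π : k.toNat.Partition => partitionRank π ≤ m).card : ℤ)
  else 0

/-- The number of partitions of an integer `k` (zero for negative `k`). -/
def intPartitionCount (k : ℤ) : ℤ := if 0 ≤ k then (Fintype.card k.toNat.Partition : ℤ) else 0

theorem rankLeCount_natCast (m : ℤ) (n : ℕ) : rankLeCount m n =
    (Finset.univ.filter fun π : n.Partition => partitionRank π ≤ m).card := by
  simp [rankLeCount]

theorem intPartitionCount_natCast (n : ℕ) :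
    intPartitionCount n = Fintype.card n.Partition := by
  simp [intPartitionCount]

theorem rankLeCount_of_neg {m k : ℤ} (hk : k < 0) : rankLeCount m k = 0 := by
  simp [rankLeCount, not_le.2 hk]

theorem intPartitionCount_of_neg {k : ℤ} (hk : k < 0) : intPartitionCount k = 0 := by
  simp [intPartitionCount, not_le.2 hk]

theorem partitionRank_le {n : ℕ} (hn : n ≠ 0) (π : n.Partition) : partitionRank π ≤ n - 1 := by
  have h1 := card_add_sup_le fun i hi => π.parts_pos hi
  have h2 := Multiset.card_pos.2 (π.parts_ne_zero hn)
  rw [π.parts_sum] at h1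
  rw [partitionRank]
  omega

theorem le_partitionRank {n : ℕ} (hn : n ≠ 0) (π : n.Partition) :
    1 - (n : ℤ) ≤ partitionRank π := by
  have h1 := card_add_sup_le fun i hi => π.parts_pos hi
  have h2 := π.parts_pos (Multiset.sup_mem_of_ne_zero (π.parts_ne_zero hn))
  rw [π.parts_sum] at h1
  rw [partitionRank]
  omega

theorem partitionRank_zero (π : Nat.Partition 0) : partitionRank π = 0 := by
  simp [partitionRank]

theorem rankLeCount_zero (m : ℤ) : rankLeCount m 0 = if 0 ≤ m then 1 else 0 := by
  have h := rankLeCount_natCast m 0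
  simp only [partitionRank_zero, Nat.cast_zero] at h
  rw [h]
  split_ifs with h0 <;> simp [h0]

theorem rankLeCount_of_le {m k : ℤ} (h : k ≤ -m) (hm : m < 0) : rankLeCount m k = 0 := by
  rcases lt_trichotomy k 0 with hk | rfl | hk
  · exact rankLeCount_of_neg hk
  · rw [rankLeCount_zero, if_neg (not_le.2 hm)]
  · lift k to ℕ using hk.le
    rw [rankLeCount_natCast, Nat.cast_eq_zero, Finset.card_eq_zero, Finset.filter_eq_empty_iff]
    intro π _ h2
    have := le_partitionRank (by omega) π
    omega

theorem rankLeCount_of_ge {m k : ℤ} (h : k ≤ m + 1) (hm : 0 ≤ m) :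
    rankLeCount m k = intPartitionCount k := by
  rcases lt_or_ge k 0 with hk | hk
  · rw [rankLeCount_of_neg hk, intPartitionCount_of_neg hk]
  · lift k to ℕ using hk
    rw [rankLeCount_natCast, intPartitionCount_natCast, Finset.filter_true_of_mem,
      Finset.card_univ]
    intro π _
    rcases eq_or_ne k 0 with rfl | hk
    · rwa [partitionRank_zero]
    · have := partitionRank_le hk π
      omega

theorem card_le_partitionRank (m : ℤ) (n : ℕ) :
    ((Finset.univ.filter fun π : n.Partition => m ≤ partitionRank π).card : ℤ) =
      intPartitionCount n - rankLeCount (m - 1) n := by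
  rw [rankLeCount_natCast, intPartitionCount_natCast, ← Finset.card_univ,
    ← Finset.card_filter_add_card_filter_not (s := Finset.univ)
      (fun π : n.Partition => m ≤ partitionRank π)]
  simp only [not_le, Nat.cast_add, Int.le_sub_one_iff]
  ring

theorem rankLeCount_recurrence (m k : ℤ) :
    rankLeCount m (k - m) + rankLeCount (m - 3) (k - 1) = intPartitionCount (k - 1) +
      (if m = 0 ∧ k = 0 then 1 else 0) - (if m = 2 ∧ k = 1 then 1 else 0) := by
  rcases lt_or_ge (k - m) 0 with h1 | h1
  · rw [rankLeCount_of_neg h1, zero_add, if_neg (by omega), add_zero]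
    rcases lt_or_ge (k - 1) 0 with h2 | h2
    · rw [rankLeCount_of_neg h2, intPartitionCount_of_neg h2, if_neg (by omega), sub_zero]
    · by_cases h3 : m = 2 ∧ k = 1
      · obtain ⟨rfl, rfl⟩ := h3
        rw [show (2 : ℤ) - 3 = -1 by norm_num, sub_self, rankLeCount_zero, if_neg (by norm_num),
          if_pos ⟨rfl, rfl⟩, ← Nat.cast_zero, intPartitionCount_natCast]
        simp
      · rw [rankLeCount_of_ge (by omega) (by omega), if_neg h3, sub_zero]
  · rcases lt_or_ge (k - 1) 0 with h2 | h2
    · rw [rankLeCount_of_neg h2, intPartitionCount_of_neg h2,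
        if_neg (c := m = 2 ∧ k = 1) (by omega)]
      by_cases h3 : m = 0 ∧ k = 0
      · obtain ⟨rfl, rfl⟩ := h3
        simp [rankLeCount_zero]
      · rw [rankLeCount_of_le (by omega) (by omega), if_neg h3]
        simp
    · obtain ⟨n, hn⟩ := Int.eq_ofNat_of_zero_le h1
      obtain ⟨N, hN⟩ := Int.eq_ofNat_of_zero_le h2
      have h := card_partitionRank_le_eq_card_le_partitionRank n N
      rw [if_neg (by omega), if_neg (by omega), hn, hN, rankLeCount_natCast,
        show m = (N : ℤ) - n + 1 by omega, h, card_le_partitionRank]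
      rw [show (N : ℤ) - n - 1 - 1 = N - n + 1 - 3 by ring]
      ring

theorem rankLeCount_add_rankLeCount_neg (m k : ℤ) :
    rankLeCount m k + rankLeCount (-1 - m) k = intPartitionCount k := by
  have hrec (m k : ℤ) : rankLeCount m (k - m) + rankLeCount (-1 - m) (k - m) -
      intPartitionCount (k - m) + (rankLeCount (m - 3) (k - 1) + rankLeCount (2 - m) (k - 1) -
        intPartitionCount (k - 1)) = 0 := by
    have h1 := rankLeCount_recurrence m k
    have h2 := rankLeCount_recurrence (2 - m) (k + 1 - m)
    rw [show k + 1 - m - (2 - m) = k - 1 by ring, show 2 - m - 3 = -1 - m by ring,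
      show k + 1 - m - 1 = k - m by ring] at h2
    have e1 : (2 - m = 0 ∧ k + 1 - m = 0) ↔ (m = 2 ∧ k = 1) := by omega
    have e2 : (2 - m = 2 ∧ k + 1 - m = 1) ↔ (m = 0 ∧ k = 0) := by omega
    rw [if_congr e1 rfl rfl, if_congr e2 rfl rfl] at h2
    linarith
  have main : ∀ (n : ℕ) (m k : ℤ), k < n →
      rankLeCount m k + rankLeCount (-1 - m) k - intPartitionCount k = 0 := by
    intro n
    induction n with
    | zero =>
      intro m k hk
      have hk : k < 0 := by simpa using hk
      simp [rankLeCount_of_neg hk, intPartitionCount_of_neg hk]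
    | succ n ih =>
      intro m k hk
      push_cast at hk
      rcases le_or_gt m 0 with hm | hm
      · have h1 := hrec m (k + m)
        have h2 := ih (m - 3) (k + m - 1) (by omega)
        rw [show k + m - m = k by ring] at h1
        rw [show -1 - (m - 3) = 2 - m by ring] at h2
        linarith
      · have h1 := hrec (m + 3) (k + 1)
        have h2 := ih (m + 3) (k + 1 - (m + 3)) (by omega)
        rw [show m + 3 - 3 = m by ring, show k + 1 - 1 = k by ring,
          show 2 - (m + 3) = -1 - m by ring] at h1
        linarith
  have := main (k + 1).toNat m k (by omega)
  linarith

theorem card_partitionRank_eq (m : ℤ) (n : ℕ) :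
    ((Finset.univ.filter fun π : n.Partition => partitionRank π = m).card : ℤ) =
      rankLeCount m n - rankLeCount (m - 1) n := by
  rw [rankLeCount_natCast, rankLeCount_natCast, eq_sub_iff_add_eq, ← Nat.cast_add,
    ← Finset.card_union_of_disjoint, Finset.filter_union_right]
  · congr 2
    ext π
    simp only [Finset.mem_filter, Finset.mem_univ, true_and]
    omega
  · rw [Finset.disjoint_filter]
    intro π _ h
    omega

theorem card_partitionRank_eq_neg (m : ℤ) (n : ℕ) :
    (Finset.univ.filter fun π : n.Partition => partitionRank π = -m).card =
      (Finset.univ.filter fun π : n.Partition => partitionRank π = m).card := by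
  have h1 := rankLeCount_add_rankLeCount_neg m n
  have h2 := rankLeCount_add_rankLeCount_neg (m - 1) n
  rw [show -1 - m = -m - 1 by ring] at h1
  rw [show -1 - (m - 1) = -m by ring] at h2
  zify
  rw [card_partitionRank_eq, card_partitionRank_eq]
  linarith

/-- The number `n (n - 1) / 2`. -/
def triangular (n : ℤ) : ℤ := n * (n - 1) / 2

theorem two_mul_triangular (n : ℤ) : 2 * triangular n = n * (n - 1) :=
  Int.mul_ediv_cancel' (Int.even_mul_pred_self n).two_dvd

theorem triangular_add_one (n : ℤ) : triangular (n + 1) = triangular n + n := by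
  have h1 := two_mul_triangular n
  have h2 := two_mul_triangular (n + 1)
  linarith

theorem triangular_one_sub (n : ℤ) : triangular (1 - n) = triangular n := by
  have h1 := two_mul_triangular n
  have h2 := two_mul_triangular (1 - n)
  linarith

theorem sub_one_le_triangular (n : ℤ) : n - 1 ≤ triangular n := by
  have h1 := two_mul_triangular n
  rcases le_or_gt n 1 with h | h <;> nlinarith

theorem neg_le_triangular (n : ℤ) : -n ≤ triangular n := by
  have h1 := sub_one_le_triangular (1 - n)
  rw [triangular_one_sub] at h1
  linarith

theorem triangular_nonneg (n : ℤ) : 0 ≤ triangular n := by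
  have h1 := sub_one_le_triangular n
  have h2 := neg_le_triangular n
  omega

section ThetaOperator

variable {K : Type*} [Field K]

/-- Doubly indexed families vanishing when the second index is negative. -/
def VanishesBelow (G : ℤ → ℤ → K) : Prop := ∀ m k, k < 0 → G m k = 0

/-- Formal multiplication of `∑ G m k z ^ m q ^ k` by the theta series
`∑ (-1) ^ n z ^ n q ^ (n (n - 1) / 2)`. -/
noncomputable def thetaOp (G : ℤ → ℤ → K) : ℤ → ℤ → K := fun l N =>
  ∑ᶠ n : ℤ, (-1 : K) ^ n * G (l - n) (N - triangular n)

/-- Backward difference in the first index. -/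
def backDiff (G : ℤ → ℤ → K) : ℤ → ℤ → K := fun m k => G m k - G (m - 1) k

theorem mem_Icc_of_triangular_le {n N : ℤ} (h : triangular n ≤ N) :
    n ∈ Finset.Icc (-N) (N + 1) := by
  have h1 := sub_one_le_triangular n
  have h2 := neg_le_triangular n
  rw [Finset.mem_Icc]
  omega

theorem VanishesBelow.support_subset {G : ℤ → ℤ → K} (hG : VanishesBelow G) (l N : ℤ) :
    (Function.support fun n : ℤ => (-1 : K) ^ n * G (l - n) (N - triangular n)) ⊆
      Finset.Icc (-N) (N + 1) := by
  intro n hn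
  by_contra h
  refine hn ?_
  have : ¬ triangular n ≤ N := fun h' => h (mem_Icc_of_triangular_le h')
  simp only
  rw [hG _ _ (by omega), mul_zero]

theorem VanishesBelow.thetaOp_eq_sum {G : ℤ → ℤ → K} (hG : VanishesBelow G) (l N : ℤ) :
    thetaOp G l N =
      ∑ n ∈ Finset.Icc (-N) (N + 1), (-1 : K) ^ n * G (l - n) (N - triangular n) :=
  finsum_eq_sum_of_support_subset _ (hG.support_subset l N)

theorem VanishesBelow.thetaOp {G : ℤ → ℤ → K} (hG : VanishesBelow G) :
    VanishesBelow (thetaOp G) := by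
  intro m k hk
  refine finsum_eq_zero_of_forall_eq_zero fun n => ?_
  rw [hG _ _ (by have := triangular_nonneg n; omega), mul_zero]

theorem VanishesBelow.backDiff {G : ℤ → ℤ → K} (hG : VanishesBelow G) :
    VanishesBelow (backDiff G) := by
  intro m k hk
  simp [_root_.backDiff, hG _ _ hk]

theorem thetaOp_neg (G : ℤ → ℤ → K) :
    thetaOp (fun m k => -G m k) = fun m k => -thetaOp G m k := by
  funext l N
  simp only [thetaOp, mul_neg]
  exact finsum_neg_distrib _

theorem thetaOp_sub {G H : ℤ → ℤ → K} (hG : VanishesBelow G) (hH : VanishesBelow H) :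
    thetaOp (fun m k => G m k - H m k) = fun m k => thetaOp G m k - thetaOp H m k := by
  funext l N
  simp only [thetaOp, mul_sub]
  exact finsum_sub_distrib ((Finset.finite_toSet _).subset (hG.support_subset l N))
    ((Finset.finite_toSet _).subset (hH.support_subset l N))

theorem thetaOp_shift (G : ℤ → ℤ → K) (a b : ℤ) :
    thetaOp (fun m k => G (m - a) (k - b)) = fun m k => thetaOp G (m - a) (k - b) := by
  funext l N
  refine finsum_congr fun n => ?_
  simp only [sub_right_comm l n a, sub_right_comm N _ b]

theorem thetaOp_shear (G : ℤ → ℤ → K) :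
    thetaOp (fun m k => G m (k - m)) = fun m k => -thetaOp G (m - 1) (k - (m - 1)) := by
  funext l N
  simp only [thetaOp]
  rw [← finsum_comp_equiv (Equiv.addRight (1 : ℤ)), ← finsum_neg_distrib]
  refine finsum_congr fun n => ?_
  rw [Equiv.coe_addRight, zpow_add_one₀ (by simp), triangular_add_one,
    show l - (n + 1) = l - 1 - n by ring,
    show N - (triangular n + n) - (l - 1 - n) = N - (l - 1) - triangular n by ring]
  ring

theorem thetaOp_backDiff {G : ℤ → ℤ → K} (hG : VanishesBelow G) :
    thetaOp (backDiff G) = backDiff (thetaOp G) := by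
  have h := thetaOp_sub hG (H := fun m k => G (m - 1) (k - 0))
    fun m k hk => hG _ _ (by simpa using hk)
  rw [thetaOp_shift] at h
  simp only [sub_zero] at h
  exact h

theorem thetaOp_eq_zero_of_backDiff_eq_zero (h2 : (2 : K) ≠ 0) {G : ℤ → ℤ → K}
    (hG : backDiff G = 0) : thetaOp G = 0 := by
  have hG' (m k : ℤ) : G m k = G 0 k := by
    have h1 (m : ℤ) : G m k = G (m - 1) k := by
      have := congrFun₂ hG m k
      exact sub_eq_zero.1 this
    induction m with
    | zero => rfl
    | succ i ih =>
      rw [h1, add_sub_cancel_right, ih]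
    | pred i ih =>
      rw [← h1, ih]
  funext l N
  have h : thetaOp G l N = -thetaOp G l N := by
    conv_lhs => rw [thetaOp, ← finsum_comp_equiv (Equiv.subLeft (1 : ℤ))]
    rw [thetaOp, ← finsum_neg_distrib]
    refine finsum_congr fun n => ?_
    rw [Equiv.subLeft_apply, triangular_one_sub, hG', hG' (l - n), zpow_sub₀ (by simp), zpow_one]
    have : ((-1 : K) ^ n) * (-1) ^ n = 1 := by rw [← mul_zpow]; simp
    field_simp
    rw [pow_two, this]
    ring
  have h' : 2 * thetaOp G l N = 0 := by
    rw [two_mul]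
    nth_rewrite 1 [h]
    ring
  simpa [h2] using h'

theorem thetaOp_thetaOp_thetaOp_shear (G : ℤ → ℤ → K) (l N : ℤ) :
    thetaOp (thetaOp (thetaOp fun m k => G m (k - m))) l N =
      -thetaOp (thetaOp (thetaOp G)) (l - 3) (N - (l - 3)) := by
  have key (H : ℤ → ℤ → K) (c : ℤ) : thetaOp (fun m k => H (m - c) (k - (m - c))) =
      fun m k => -thetaOp H (m - (c + 1)) (k - (m - (c + 1))) := by
    have h := thetaOp_shift (fun m k => H m (k - m)) c 0
    simp only [sub_zero] at h
    rw [h, thetaOp_shear]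
    funext m k
    simp only [sub_sub]
  have h0 : (fun m k => G m (k - m)) = fun m k => G (m - 0) (k - (m - 0)) := by
    simp only [sub_zero]
  rw [h0, key, thetaOp_neg, key]
  simp only [neg_neg]
  rw [key]
  norm_num

theorem thetaOp_thetaOp_thetaOp_eq_zero (h2 : (2 : K) ≠ 0) {G : ℤ → ℤ → K}
    (hG : VanishesBelow G) (h : backDiff (backDiff (backDiff G)) = 0) :
    thetaOp (thetaOp (thetaOp G)) = 0 := by
  have h1 := thetaOp_eq_zero_of_backDiff_eq_zero h2 h
  rw [thetaOp_backDiff hG.backDiff, thetaOp_backDiff hG] at h1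
  have h3 := thetaOp_eq_zero_of_backDiff_eq_zero h2 h1
  rw [thetaOp_backDiff hG.thetaOp] at h3
  exact thetaOp_eq_zero_of_backDiff_eq_zero h2 h3

end ThetaOperator

instance factPrimeEleven : Fact (Nat.Prime 11) := ⟨by norm_num⟩

/-- A quadratic weight on pairs `(m, k)` modulo 11. -/
def rankWeight (m k : ℤ) : ZMod 11 := 3 * k + 6 * m * (m + 1)

/-- The weighted cumulative rank counts modulo 11. -/
def weightedRankLe (m k : ℤ) : ZMod 11 := rankWeight m k * rankLeCount m k

theorem zmod11_two_ne_zero : (2 : ZMod 11) ≠ 0 := by decide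

theorem zmod11_eleven : (11 : ZMod 11) = 0 := by decide

theorem vanishesBelow_weightedRankLe : VanishesBelow weightedRankLe := by
  intro m k hk
  simp [weightedRankLe, rankLeCount_of_neg hk]

theorem weightedRankLe_recurrence (m k : ℤ) : weightedRankLe m (k - m) =
    (3 * k + 6 * m ^ 2 + 3 * m : ZMod 11) * intPartitionCount (k - 1) -
      weightedRankLe (m - 3) (k - 1) := by
  have h := congrArg (Int.cast : ℤ → ZMod 11) (rankLeCount_recurrence m k)
  push_cast at h
  have e1 : (3 * k + 6 * m ^ 2 + 3 * m : ZMod 11) * (if m = 0 ∧ k = 0 then 1 else 0) = 0 := by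
    split_ifs with h
    · simp [h.1, h.2]
    · simp
  have e2 : (3 * k + 6 * m ^ 2 + 3 * m : ZMod 11) * (if m = 2 ∧ k = 1 then 1 else 0) = 0 := by
    split_ifs with h
    · rw [h.1, h.2]; decide
    · simp
  simp only [weightedRankLe, rankWeight]
  push_cast
  linear_combination (3 * k + 6 * m ^ 2 + 3 * m : ZMod 11) * h + e1 - e2 +
    (rankLeCount (m - 3) (k - 1) : ZMod 11) * (3 - 3 * m) * zmod11_eleven

theorem vanishesBelow_weightedRankLe_shear :
    VanishesBelow fun m k => weightedRankLe m (k - m) := by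
  intro m k hk
  rcases lt_or_ge m 0 with hm | hm
  · simp [weightedRankLe, rankLeCount_of_le (show k - m ≤ -m by omega) hm]
  · simp [weightedRankLe, rankLeCount_of_neg (show k - m < 0 by omega)]

theorem thetaOp_weightedRankLe_eq (l k : ℤ) :
    thetaOp (thetaOp (thetaOp weightedRankLe)) l k =
      thetaOp (thetaOp (thetaOp weightedRankLe)) l (k + l - 1) := by
  have hs : VanishesBelow fun m k => weightedRankLe (m - 3) (k - 1) :=
    fun m k hk => vanishesBelow_weightedRankLe _ _ (by omega)
  set ρ : ℤ → ℤ → ZMod 11 := fun m k =>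
    weightedRankLe m (k - m) - -weightedRankLe (m - 3) (k - 1) with hρ
  have hs' : VanishesBelow fun m k => -weightedRankLe (m - 3) (k - 1) :=
    fun m k hk => neg_eq_zero.2 (hs m k hk)
  have hρ0 : VanishesBelow ρ := fun m k hk => by
    have h1 := vanishesBelow_weightedRankLe_shear m k hk
    have h2 := hs' m k hk
    simp only at h1 h2
    simp only [hρ, h1, h2, sub_zero]
  have hd : backDiff (backDiff (backDiff ρ)) = 0 := by
    funext m k
    simp only [hρ, weightedRankLe_recurrence, backDiff, Pi.zero_apply]
    push_cast
    ring
  have h := thetaOp_thetaOp_thetaOp_eq_zero zmod11_two_ne_zero hρ0 hd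
  rw [hρ, thetaOp_sub vanishesBelow_weightedRankLe_shear hs',
    thetaOp_sub vanishesBelow_weightedRankLe_shear.thetaOp hs'.thetaOp,
    thetaOp_sub vanishesBelow_weightedRankLe_shear.thetaOp.thetaOp hs'.thetaOp.thetaOp,
    thetaOp_neg, thetaOp_neg, thetaOp_neg, thetaOp_shift, thetaOp_shift, thetaOp_shift] at h
  have h1 := congrFun₂ h (l + 3) (k + l)
  simp only [thetaOp_thetaOp_thetaOp_shear, Pi.zero_apply] at h1
  rw [show l + 3 - 3 = l by ring, show k + l - l = k by ring] at h1
  linear_combination -h1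

theorem thetaOp_weightedRankLe_eq_zero {l : ℤ} (hl : l ≠ 1) (k : ℤ) :
    thetaOp (thetaOp (thetaOp weightedRankLe)) l k = 0 := by
  have h0 := vanishesBelow_weightedRankLe.thetaOp.thetaOp.thetaOp
  have main : ∀ (n : ℕ) (k : ℤ), k < n →
      thetaOp (thetaOp (thetaOp weightedRankLe)) l k = 0 := by
    intro n
    induction n with
    | zero => exact fun k hk => h0 _ _ (by simpa using hk)
    | succ n ih =>
      intro k hk
      push_cast at hk
      rcases lt_or_gt_of_ne hl with h | h
      · rw [thetaOp_weightedRankLe_eq]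
        exact ih _ (by omega)
      · have := thetaOp_weightedRankLe_eq l (k - l + 1)
        rw [show k - l + 1 + l - 1 = k by ring] at this
        rw [← this]
        exact ih _ (by omega)
  exact main (k + 1).toNat k (by omega)

section Laurent

open scoped LaurentPolynomial

theorem sum_Ioo_neg_succ {M : Type*} [AddCommMonoid M] (f : ℤ → M) {j : ℤ} (hj : 0 < j) :
    ∑ i ∈ Finset.Ioo (-(j + 1)) (j + 1), f i = f j + (f (-j) + ∑ i ∈ Finset.Ioo (-j) j, f i) := by
  have h : Finset.Ioo (-(j + 1)) (j + 1) = insert j (insert (-j) (Finset.Ioo (-j) j)) := by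
    ext i
    simp only [Finset.mem_Ioo, Finset.mem_insert]
    omega
  rw [h, Finset.sum_insert, Finset.sum_insert] <;> simp
  omega

section

variable {K : Type*} [Field K]

theorem one_sub_T_mul_sum (n : ℤ) (hn : 1 ≤ n) :
    (1 - LaurentPolynomial.T 1 : K[T;T⁻¹]) * ∑ i ∈ Finset.Ioo (-n) n, LaurentPolynomial.T i =
      LaurentPolynomial.T (1 - n) - LaurentPolynomial.T n := by
  induction n, hn using Int.leInduction with
  | base =>
    rw [show Finset.Ioo (-1 : ℤ) 1 = {0} from rfl]
    simp
  | succ n hn ih =>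
    rw [sum_Ioo_neg_succ _ (by omega), mul_add, mul_add, ih, sub_mul, sub_mul, one_mul, one_mul,
      ← LaurentPolynomial.T_add, ← LaurentPolynomial.T_add]
    rw [show 1 - (n + 1) = -n by ring, show 1 + -n = 1 - n by ring, add_comm 1 n]
    ring

theorem coeff_C_mul_T_mul (a : K) (n m : ℤ) (f : K[T;T⁻¹]) :
    (LaurentPolynomial.C a * LaurentPolynomial.T n * f).coeff m = a * f.coeff (m - n) := by
  rw [← LaurentPolynomial.single_eq_C_mul_T, AddMonoidAlgebra.coeff_single_mul_apply]
  congr 2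
  ring

theorem coeff_T_mul (n m : ℤ) (f : K[T;T⁻¹]) :
    (LaurentPolynomial.T n * f).coeff m = f.coeff (m - n) := by
  have := coeff_C_mul_T_mul (1 : K) n m f
  simpa using this

variable (K) in
/-- The theta series `∑ (-1) ^ n z ^ n q ^ (n (n - 1) / 2)`. -/
noncomputable def thetaSeries : PowerSeries K[T;T⁻¹] := PowerSeries.mk fun k =>
  ∑ n ∈ Finset.Icc (-(k : ℤ)) (k + 1) with triangular n = k,
    LaurentPolynomial.C ((-1) ^ n) * LaurentPolynomial.T n

variable (K) in
/-- The quotient of the theta series by `1 - z`. -/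
noncomputable def psiSeries : PowerSeries K[T;T⁻¹] := PowerSeries.mk fun k =>
  ∑ n ∈ Finset.Icc 1 ((k : ℤ) + 1) with triangular n = k,
    LaurentPolynomial.C ((-1) ^ (n - 1)) * ∑ i ∈ Finset.Ioo (-n) n, LaurentPolynomial.T i

theorem thetaSeries_eq :
    thetaSeries K = PowerSeries.C (1 - LaurentPolynomial.T 1) * psiSeries K := by
  ext1 k
  rw [PowerSeries.coeff_C_mul, thetaSeries, psiSeries, PowerSeries.coeff_mk, PowerSeries.coeff_mk,
    Finset.mul_sum]
  have h1 : ∀ n ∈ (Finset.Icc 1 ((k : ℤ) + 1)).filter (triangular · = k),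
      (1 - LaurentPolynomial.T 1) * (LaurentPolynomial.C ((-1 : K) ^ (n - 1)) *
        ∑ i ∈ Finset.Ioo (-n) n, LaurentPolynomial.T i) =
      LaurentPolynomial.C ((-1) ^ n) * LaurentPolynomial.T n +
        LaurentPolynomial.C ((-1) ^ (1 - n)) * LaurentPolynomial.T (1 - n) := by
    intro n hn
    rw [Finset.mem_filter, Finset.mem_Icc] at hn
    rw [mul_left_comm, one_sub_T_mul_sum n hn.1.1, zpow_sub_one₀ (by simp),
      zpow_sub₀ (by simp)]
    have : ((-1 : K) ^ n)⁻¹ = (-1) ^ n := by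
      rw [← inv_zpow]; norm_num
    rw [zpow_one, div_eq_mul_inv, this]
    have h : ((-1 : K) ^ n * (-1)⁻¹) = -(-1) ^ n := by norm_num
    rw [h, neg_one_mul, map_neg]
    ring
  rw [Finset.sum_congr rfl h1, Finset.sum_add_distrib,
    ← Finset.sum_filter_add_sum_filter_not _ (fun n => 1 ≤ n), Finset.filter_filter,
    Finset.filter_filter]
  congr 1
  · refine Finset.sum_congr ?_ fun _ _ => rfl
    ext n
    simp only [Finset.mem_filter, Finset.mem_Icc]
    omega
  · refine Finset.sum_nbij' (fun n => 1 - n) (fun n => 1 - n) ?_ ?_ ?_ ?_ ?_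
    · intro n hn
      simp only [Finset.mem_filter, Finset.mem_Icc, triangular_one_sub] at hn ⊢
      omega
    · intro n hn
      simp only [Finset.mem_filter, Finset.mem_Icc, triangular_one_sub] at hn ⊢
      omega
    · intro n _; ring
    · intro n _; ring
    · intro n _; rw [sub_sub_cancel]

/-- The doubly indexed coefficients of a power series with Laurent polynomial coefficients. -/
noncomputable def bicoeff (b : PowerSeries K[T;T⁻¹]) : ℤ → ℤ → K := fun m k =>
  if 0 ≤ k then (PowerSeries.coeff k.toNat b).coeff m else 0

theorem bicoeff_natCast (b : PowerSeries K[T;T⁻¹]) (m : ℤ) (k : ℕ) :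
    bicoeff b m k = (PowerSeries.coeff k b).coeff m := by
  simp [bicoeff]

theorem bicoeff_of_neg (b : PowerSeries K[T;T⁻¹]) (m : ℤ) {k : ℤ} (hk : k < 0) :
    bicoeff b m k = 0 := by
  simp [bicoeff, not_le.2 hk]

theorem vanishesBelow_bicoeff (b : PowerSeries K[T;T⁻¹]) : VanishesBelow (bicoeff b) :=
  fun m _ hk => bicoeff_of_neg b m hk

theorem bicoeff_injective {b c : PowerSeries K[T;T⁻¹]} (h : bicoeff b = bicoeff c) : b = c := by
  ext1 k
  refine LaurentPolynomial.ext fun m => ?_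
  rw [← bicoeff_natCast, ← bicoeff_natCast, h]

theorem VanishesBelow.ext {G H : ℤ → ℤ → K} (hG : VanishesBelow G) (hH : VanishesBelow H)
    (h : ∀ (m : ℤ) (k : ℕ), G m k = H m k) : G = H := by
  funext m k
  rcases lt_or_ge k 0 with hk | hk
  · rw [hG m k hk, hH m k hk]
  · lift k to ℕ using hk
    exact h m k

theorem bicoeff_one_sub_T_mul (b : PowerSeries K[T;T⁻¹]) :
    bicoeff (PowerSeries.C (1 - LaurentPolynomial.T 1) * b) = backDiff (bicoeff b) := by
  refine VanishesBelow.ext (vanishesBelow_bicoeff _) (vanishesBelow_bicoeff _).backDiff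
    fun m k => ?_
  rw [backDiff, bicoeff_natCast, bicoeff_natCast, bicoeff_natCast, PowerSeries.coeff_C_mul,
    sub_mul, one_mul, ← coeff_T_mul]
  rfl

theorem bicoeff_thetaSeries_mul (b : PowerSeries K[T;T⁻¹]) :
    bicoeff (thetaSeries K * b) = thetaOp (bicoeff b) := by
  refine VanishesBelow.ext (vanishesBelow_bicoeff _) (vanishesBelow_bicoeff _).thetaOp
    fun m N => ?_
  rw [(vanishesBelow_bicoeff _).thetaOp_eq_sum, bicoeff_natCast, PowerSeries.coeff_mul,
    AddMonoidAlgebra.coeff_sum, Finset.sum_apply']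
  have h1 : ∀ x ∈ Finset.HasAntidiagonal.antidiagonal N,
      (PowerSeries.coeff x.1 (thetaSeries K) * PowerSeries.coeff x.2 b).coeff m =
      ∑ n ∈ Finset.Icc (-(N : ℤ)) (N + 1) with triangular n = x.1,
        (-1 : K) ^ n * bicoeff b (m - n) (N - triangular n) := by
    intro x hx
    rw [Finset.HasAntidiagonal.mem_antidiagonal] at hx
    rw [thetaSeries, PowerSeries.coeff_mk, Finset.sum_mul, AddMonoidAlgebra.coeff_sum,
      Finset.sum_apply']
    refine Finset.sum_congr ?_ fun n hn => ?_
    · ext n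
      have := mem_Icc_of_triangular_le (n := n) (N := x.1)
      simp only [Finset.mem_filter, Finset.mem_Icc] at this ⊢
      omega
    · have hn := (Finset.mem_filter.1 hn).2
      rw [coeff_C_mul_T_mul, hn, show (N : ℤ) - x.1 = x.2 by omega, bicoeff_natCast]
  rw [Finset.sum_congr rfl h1, Finset.Nat.sum_antidiagonal_eq_sum_range_succ_mk]
  simp only [Finset.sum_filter]
  rw [Finset.sum_comm]
  refine Finset.sum_congr rfl fun n _ => ?_
  by_cases hn : triangular n ≤ N
  · rw [Finset.sum_eq_single (triangular n).toNat]
    · rw [if_pos (Int.toNat_of_nonneg (triangular_nonneg n)).symm]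
    · intro k _ hk
      rw [if_neg]
      omega
    · intro h
      rw [Finset.mem_range] at h
      omega
  · rw [bicoeff_of_neg _ _ (by omega), mul_zero]
    simp
end

/-- The contribution of a partition of `n` of rank `r` to `rankSeries`. -/
noncomputable def rankTerm (n r : ℤ) : (ZMod 11)[T;T⁻¹] :=
  LaurentPolynomial.C (rankWeight r n) * LaurentPolynomial.T (r + 1) +
  LaurentPolynomial.C (rankWeight r n) * LaurentPolynomial.T (r - 1) +
  LaurentPolynomial.C (-2 * rankWeight r n + r + 1) * LaurentPolynomial.T r +
  LaurentPolynomial.C (-r : ZMod 11) * LaurentPolynomial.T (r + 1)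

/-- A weighted generating function of ranks; up to a shift its coefficients are the third
differences of `weightedRankLe`. -/
noncomputable def rankSeries : PowerSeries (ZMod 11)[T;T⁻¹] := PowerSeries.mk fun n =>
  ∑ π : n.Partition, rankTerm n (partitionRank π)

theorem coeff_rankTerm (n r m : ℤ) : (rankTerm n r).coeff m =
    (rankWeight (m - 1) n - (m - 1)) * (if r = m - 1 then 1 else 0) +
    rankWeight (m + 1) n * (if r = m + 1 then 1 else 0) +
    (-2 * rankWeight m n + m + 1) * (if r = m then 1 else 0) := by
  have h (a : ZMod 11) (j : ℤ) :
      (LaurentPolynomial.C a * LaurentPolynomial.T j).coeff m = if j = m then a else 0 := by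
    rw [← LaurentPolynomial.single_eq_C_mul_T, AddMonoidAlgebra.coeff_single, Finsupp.single_apply]
  simp only [rankTerm, AddMonoidAlgebra.coeff_add, Finsupp.add_apply, h]
  rcases eq_or_ne r (m - 1) with rfl | h1
  · simp [show m - 1 ≠ m by omega, show m - 1 ≠ m + 1 by omega, show m - 1 - 1 ≠ m by omega]
    ring
  rcases eq_or_ne r (m + 1) with rfl | h2
  · simp [show m + 1 ≠ m - 1 by omega, show m + 1 + 1 ≠ m by omega]
  rcases eq_or_ne r m with rfl | h3
  · simp [h1]
  · simp [h1, h2, h3, show r + 1 ≠ m by omega, show r - 1 ≠ m by omega]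

theorem bicoeff_rankSeries :
    bicoeff rankSeries = fun m k => backDiff (backDiff (backDiff weightedRankLe)) (m + 1) k := by
  refine VanishesBelow.ext (vanishesBelow_bicoeff _)
    (fun m k hk => vanishesBelow_weightedRankLe.backDiff.backDiff.backDiff _ _ hk) fun m k => ?_
  have hc (j : ℤ) : ∑ π : k.Partition, (if partitionRank π = j then (1 : ZMod 11) else 0) =
      rankLeCount j k - rankLeCount (j - 1) k := by
    rw [Finset.sum_boole]
    exact_mod_cast congrArg (Int.cast : ℤ → ZMod 11) (card_partitionRank_eq j k)
  rw [bicoeff_natCast, rankSeries, PowerSeries.coeff_mk, AddMonoidAlgebra.coeff_sum,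
    Finset.sum_apply']
  simp only [coeff_rankTerm, Finset.sum_add_distrib, ← Finset.mul_sum, hc]
  simp only [backDiff, weightedRankLe, rankWeight, add_sub_cancel_right]
  rw [show m - 1 - 1 = m - 2 by ring]
  push_cast
  linear_combination (rankLeCount m k * (-m - 1) + rankLeCount (m - 1) k * (2 * m) -
    rankLeCount (m - 2) k * (m - 1)) * zmod11_eleven

/-- The power series whose coefficients are the only nonzero row of
`thetaOp (thetaOp (thetaOp weightedRankLe))`. -/
noncomputable def thetaRow : PowerSeries (ZMod 11) := PowerSeries.mk fun k =>
  thetaOp (thetaOp (thetaOp weightedRankLe)) 1 k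

theorem bicoeff_map_thetaRow : bicoeff (PowerSeries.map LaurentPolynomial.C thetaRow) =
    fun m k => thetaOp (thetaOp (thetaOp weightedRankLe)) (m + 1) k := by
  refine VanishesBelow.ext (vanishesBelow_bicoeff _)
    (fun m k hk => vanishesBelow_weightedRankLe.thetaOp.thetaOp.thetaOp _ _ hk) fun m k => ?_
  rw [bicoeff_natCast, PowerSeries.coeff_map, thetaRow, PowerSeries.coeff_mk,
    LaurentPolynomial.C_apply]
  split_ifs with h
  · rw [h, zero_add]
  · rw [thetaOp_weightedRankLe_eq_zero (by omega)]

theorem psiSeries_pow_mul_rankSeries :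
    psiSeries (ZMod 11) * (psiSeries (ZMod 11) * (psiSeries (ZMod 11) * rankSeries)) =
      PowerSeries.map LaurentPolynomial.C thetaRow := by
  set c : PowerSeries (ZMod 11)[T;T⁻¹] := PowerSeries.C (1 - LaurentPolynomial.T 1) with hc
  have hc0 : c ≠ 0 := by
    rw [hc, Ne, map_eq_zero_iff _ PowerSeries.C_injective, sub_eq_zero]
    intro h
    have := congrArg (fun f : (ZMod 11)[T;T⁻¹] => f.coeff 1) h
    simp only [← LaurentPolynomial.T_zero, LaurentPolynomial.T_apply] at this
    simp at this
  have key : thetaSeries (ZMod 11) * (thetaSeries (ZMod 11) *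
      (thetaSeries (ZMod 11) * rankSeries)) =
      c * (c * (c * PowerSeries.map LaurentPolynomial.C thetaRow)) := by
    apply bicoeff_injective
    rw [bicoeff_thetaSeries_mul, bicoeff_thetaSeries_mul, bicoeff_thetaSeries_mul,
      bicoeff_one_sub_T_mul, bicoeff_one_sub_T_mul, bicoeff_one_sub_T_mul, bicoeff_rankSeries,
      bicoeff_map_thetaRow]
    have hs (G : ℤ → ℤ → ZMod 11) : thetaOp (fun m k => G (m + 1) k) =
        fun m k => thetaOp G (m + 1) k := by
      simpa using thetaOp_shift G (-1) 0
    have hd (G : ℤ → ℤ → ZMod 11) : backDiff (fun m k => G (m + 1) k) =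
        fun m k => backDiff G (m + 1) k := by
      funext m k
      simp [backDiff]
    have hv := vanishesBelow_weightedRankLe
    rw [hs, hs, hs, hd, hd, hd, thetaOp_backDiff hv.backDiff.backDiff, thetaOp_backDiff hv.backDiff,
      thetaOp_backDiff hv, thetaOp_backDiff hv.thetaOp.backDiff.backDiff,
      thetaOp_backDiff hv.thetaOp.backDiff, thetaOp_backDiff hv.thetaOp,
      thetaOp_backDiff hv.thetaOp.thetaOp.backDiff.backDiff,
      thetaOp_backDiff hv.thetaOp.thetaOp.backDiff, thetaOp_backDiff hv.thetaOp.thetaOp]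
  rw [thetaSeries_eq, ← hc] at key
  refine mul_left_cancel₀ (pow_ne_zero 3 hc0) ?_
  linear_combination key

section Moments

variable {K : Type*} [Field K]

/-- The `a`-th moment of a Laurent polynomial. -/
noncomputable def laurentMoment (a : ℕ) : K[T;T⁻¹] →+ K :=
  (Finsupp.liftAddHom fun m : ℤ => AddMonoidHom.mulRight ((m : K) ^ a)).comp
    (AddMonoidAlgebra.coeffAddEquiv (R := K) (M := ℤ)).toAddMonoidHom

theorem laurentMoment_single (a : ℕ) (m : ℤ) (c : K) :
    laurentMoment a (AddMonoidAlgebra.single m c) = c * (m : K) ^ a := by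
  simp only [laurentMoment, AddMonoidHom.comp_apply]
  exact (Finsupp.liftAddHom_apply_single _ m c)

theorem laurentMoment_C_mul_T (a : ℕ) (m : ℤ) (c : K) :
    laurentMoment a (LaurentPolynomial.C c * LaurentPolynomial.T m) = c * (m : K) ^ a := by
  rw [← LaurentPolynomial.single_eq_C_mul_T, laurentMoment_single]

theorem laurentMoment_mul (a : ℕ) (x y : K[T;T⁻¹]) : laurentMoment a (x * y) =
    ∑ i ∈ Finset.range (a + 1), laurentMoment i x * laurentMoment (a - i) y * a.choose i := by
  induction x using AddMonoidAlgebra.induction_linear with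
  | zero => simp
  | add x x' hx hx' => simp only [add_mul, map_add, hx, hx', Finset.sum_add_distrib]
  | single m r =>
    induction y using AddMonoidAlgebra.induction_linear with
    | zero => simp
    | add y y' hy hy' =>
      simp only [mul_add, add_mul, map_add, hy, hy', Finset.sum_add_distrib]
    | single n s =>
      rw [AddMonoidAlgebra.single_mul_single]
      simp only [laurentMoment_single]
      push_cast
      rw [add_pow, Finset.mul_sum]
      refine Finset.sum_congr rfl fun i _ => ?_
      ring

/-- The `a`-th moment of a power series with Laurent polynomial coefficients. -/
noncomputable def seriesMoment (a : ℕ) (b : PowerSeries K[T;T⁻¹]) : PowerSeries K :=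
  PowerSeries.mk fun n => laurentMoment a (PowerSeries.coeff n b)

theorem seriesMoment_mul (a : ℕ) (x y : PowerSeries K[T;T⁻¹]) : seriesMoment a (x * y) =
    ∑ i ∈ Finset.range (a + 1),
      seriesMoment i x * seriesMoment (a - i) y * (a.choose i : PowerSeries K) := by
  ext1 n
  rw [map_sum, seriesMoment, PowerSeries.coeff_mk, PowerSeries.coeff_mul, map_sum]
  simp only [laurentMoment_mul]
  rw [Finset.sum_comm]
  refine Finset.sum_congr rfl fun i _ => ?_
  rw [← map_natCast (PowerSeries.C (R := K)), PowerSeries.coeff_mul_C, PowerSeries.coeff_mul,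
    Finset.sum_mul]
  simp only [seriesMoment, PowerSeries.coeff_mk]

/-- The first and third moments vanish. -/
def OddMomentsVanish (x : PowerSeries K[T;T⁻¹]) : Prop :=
  seriesMoment 1 x = 0 ∧ seriesMoment 3 x = 0

variable {x y : PowerSeries K[T;T⁻¹]}

theorem seriesMoment_zero_mul (x y : PowerSeries K[T;T⁻¹]) :
    seriesMoment 0 (x * y) = seriesMoment 0 x * seriesMoment 0 y := by
  simp [seriesMoment_mul]

theorem OddMomentsVanish.seriesMoment_two_mul (hx : OddMomentsVanish x) :
    seriesMoment 2 (x * y) =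
      seriesMoment 0 x * seriesMoment 2 y + seriesMoment 2 x * seriesMoment 0 y := by
  simp [seriesMoment_mul, Finset.sum_range_succ, hx.1]

theorem OddMomentsVanish.seriesMoment_four_mul (hx : OddMomentsVanish x) :
    seriesMoment 4 (x * y) =
      seriesMoment 0 x * seriesMoment 4 y + 6 * (seriesMoment 2 x * seriesMoment 2 y) +
        seriesMoment 4 x * seriesMoment 0 y := by
  simp [seriesMoment_mul, Finset.sum_range_succ, hx.1, hx.2, show Nat.choose 4 2 = 6 from rfl]
  ring

theorem seriesMoment_map_C {a : ℕ} (ha : a ≠ 0) (f : PowerSeries K) :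
    seriesMoment a (PowerSeries.map LaurentPolynomial.C f) = 0 := by
  ext1 n
  rw [seriesMoment, PowerSeries.coeff_mk, PowerSeries.coeff_map]
  have := laurentMoment_C_mul_T a 0 (PowerSeries.coeff n f)
  rw [LaurentPolynomial.T_zero, mul_one] at this
  simp [this, ha]

end Moments

section QDeriv

variable {K : Type*} [Field K]

variable (K) in
/-- The derivation `q d/dq` on power series. -/
noncomputable def qDeriv : Derivation K (PowerSeries K) (PowerSeries K) :=
  (PowerSeries.X : PowerSeries K) • PowerSeries.derivative K

@[simp]
theorem coeff_qDeriv (n : ℕ) (f : PowerSeries K) :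
    PowerSeries.coeff n (qDeriv K f) = n * PowerSeries.coeff n f := by
  rw [qDeriv, Derivation.smul_apply, smul_eq_mul]
  cases n with
  | zero => simp
  | succ n =>
    rw [PowerSeries.coeff_succ_X_mul, PowerSeries.coeff_derivative]
    push_cast
    ring

theorem qDeriv_mul (f g : PowerSeries K) :
    qDeriv K (f * g) = f * qDeriv K g + g * qDeriv K f := by
  rw [Derivation.leibniz, smul_eq_mul, smul_eq_mul]

@[simp]
theorem constantCoeff_qDeriv (f : PowerSeries K) : PowerSeries.constantCoeff (qDeriv K f) = 0 := by
  rw [← PowerSeries.coeff_zero_eq_constantCoeff_apply, coeff_qDeriv]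
  simp

end QDeriv

theorem powerSeriesMk_card_partition_mul_pentagonalSeries (R : Type*) [CommRing R]
    [NoZeroDivisors R] :
    (PowerSeries.mk fun n => (Fintype.card n.Partition : R)) * PowerSeries.pentagonalSeries R =
      1 := by
  let _ : TopologicalSpace R := ⊥
  have : DiscreteTopology R := ⟨rfl⟩
  nontriviality R
  open PowerSeries.WithPiTopology in
  have h1 := Nat.Partition.hasProd_powerSeriesMk_card_restricted R (fun _ => True)
  open PowerSeries.WithPiTopology in
  have h2 := h1.mul (hasProd_one_sub_X_pow R)
  have h3 : ∀ n, Nat.Partition.restricted n (fun _ => True) = Finset.univ := by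
    intro n
    simp [Nat.Partition.restricted]
  simp only [h3, Finset.card_univ, if_true] at h2
  open PowerSeries.WithPiTopology in
  have h4 : (fun i : ℕ => (∑' j : ℕ, (PowerSeries.X : PowerSeries R) ^ ((i + 1) * j)) *
      (1 - PowerSeries.X ^ (i + 1))) = fun _ => 1 := by
    funext i
    simp_rw [pow_mul]
    exact tsum_pow_mul_one_sub_of_constantCoeff_eq_zero (by simp)
  rw [h4] at h2
  exact h2.unique hasProd_one

/-- The generating function of the partition numbers modulo 11. -/
noncomputable def partitionSeries : PowerSeries (ZMod 11) :=
  PowerSeries.mk fun n => (Fintype.card n.Partition : ZMod 11)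

/-- The generating function of the moments of the rank modulo 11. -/
noncomputable def rankMomentSeries (a : ℕ) : PowerSeries (ZMod 11) :=
  PowerSeries.mk fun n => ∑ π : n.Partition, (partitionRank π : ZMod 11) ^ a

theorem seriesMoment_rankSeries (a : ℕ) : seriesMoment a rankSeries = PowerSeries.mk fun n =>
    ∑ π : n.Partition, (rankWeight (partitionRank π) n * ((partitionRank π : ZMod 11) + 1) ^ a +
      rankWeight (partitionRank π) n * ((partitionRank π : ZMod 11) - 1) ^ a +
      (-2 * rankWeight (partitionRank π) n + partitionRank π + 1) * (partitionRank π : ZMod 11) ^ a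
      - partitionRank π * ((partitionRank π : ZMod 11) + 1) ^ a) := by
  ext1 n
  rw [seriesMoment, PowerSeries.coeff_mk, rankSeries, PowerSeries.coeff_mk, map_sum,
    PowerSeries.coeff_mk]
  refine Finset.sum_congr rfl fun π _ => ?_
  simp only [rankTerm, AddMonoidHom.map_add, laurentMoment_C_mul_T]
  push_cast
  ring

theorem seriesMoment_zero_rankSeries : seriesMoment 0 rankSeries = partitionSeries := by
  rw [seriesMoment_rankSeries, partitionSeries]
  congr with n
  rw [← Finset.card_univ, Finset.cast_card]
  refine Finset.sum_congr rfl fun π _ => ?_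
  ring

theorem seriesMoment_two_rankSeries :
    seriesMoment 2 rankSeries = 6 * qDeriv _ partitionSeries := by
  ext1 n
  rw [show (6 : PowerSeries (ZMod 11)) = PowerSeries.C 6 from (map_ofNat _ 6).symm,
    PowerSeries.coeff_C_mul, coeff_qDeriv,
    seriesMoment_rankSeries, partitionSeries, PowerSeries.coeff_mk, PowerSeries.coeff_mk,
    ← Finset.card_univ, Finset.cast_card, Finset.mul_sum, Finset.mul_sum]
  have : ∀ r : ZMod 11, (3 * n + 6 * r * (r + 1)) * (r + 1) ^ 2 +
      (3 * n + 6 * r * (r + 1)) * (r - 1) ^ 2 + (-2 * (3 * n + 6 * r * (r + 1)) + r + 1) * r ^ 2 -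
      r * (r + 1) ^ 2 = 6 * (n * 1) + 11 * r ^ 2 + 11 * r := by
    intro r
    ring
  rw [← sub_eq_zero, ← Finset.sum_sub_distrib]
  refine Finset.sum_eq_zero fun π _ => ?_
  simp only [rankWeight]
  push_cast
  linear_combination this (partitionRank π) +
    ((partitionRank π : ZMod 11) ^ 2 + partitionRank π) * zmod11_eleven

theorem seriesMoment_four_rankSeries :
    seriesMoment 4 rankSeries = 3 * qDeriv _ (rankMomentSeries 2) + 6 * qDeriv _ partitionSeries +
      3 * rankMomentSeries 4 + 8 * rankMomentSeries 2 := by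
  ext1 n
  rw [← map_ofNat PowerSeries.C 3, ← map_ofNat PowerSeries.C 6, ← map_ofNat PowerSeries.C 8]
  simp only [map_add, PowerSeries.coeff_C_mul, coeff_qDeriv, seriesMoment_rankSeries,
    partitionSeries, rankMomentSeries, PowerSeries.coeff_mk]
  have h : ∀ r : ZMod 11, (3 * n + 6 * r * (r + 1)) * (r + 1) ^ 4 +
      (3 * n + 6 * r * (r + 1)) * (r - 1) ^ 4 +
      (-2 * (3 * n + 6 * r * (r + 1)) + r + 1) * r ^ 4 - r * (r + 1) ^ 4 =
      3 * (n * r ^ 2) + 6 * (n * 1) + 3 * r ^ 4 + 8 * r ^ 2 := by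
    intro r
    linear_combination (3 * n * r ^ 2 + 6 * r ^ 4 + 6 * r ^ 3 + r) * zmod11_eleven
  rw [← Finset.card_univ, Finset.cast_card]
  simp only [rankWeight]
  push_cast
  simp only [h, Finset.sum_add_distrib, ← Finset.mul_sum]

section PowerSums

variable {R : Type*} [CommRing R]

theorem sum_Ioo_neg_odd_pow (n : ℤ) (hn : 1 ≤ n) {a : ℕ} (ha : Odd a) :
    ∑ i ∈ Finset.Ioo (-n) n, (i : R) ^ a = 0 := by
  induction n, hn using Int.leInduction with
  | base => simp [show Finset.Ioo (-1 : ℤ) 1 = {0} from rfl, ha.pos.ne']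
  | succ n hn ih =>
    rw [sum_Ioo_neg_succ _ (by omega), ih]
    push_cast
    rw [ha.neg_pow]
    ring

theorem sum_Ioo_neg_pow_zero (n : ℤ) (hn : 1 ≤ n) :
    ∑ i ∈ Finset.Ioo (-n) n, (i : R) ^ 0 = 2 * n - 1 := by
  induction n, hn using Int.leInduction with
  | base =>
    simp [show Finset.Ioo (-1 : ℤ) 1 = {0} from rfl]
    ring
  | succ n hn ih =>
    rw [sum_Ioo_neg_succ _ (by omega), ih]
    push_cast
    ring

theorem three_mul_sum_Ioo_neg_sq (n : ℤ) (hn : 1 ≤ n) :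
    3 * ∑ i ∈ Finset.Ioo (-n) n, (i : R) ^ 2 = n * (n - 1) * (2 * n - 1) := by
  induction n, hn using Int.leInduction with
  | base => simp [show Finset.Ioo (-1 : ℤ) 1 = {0} from rfl]
  | succ n hn ih =>
    rw [sum_Ioo_neg_succ _ (by omega), mul_add, mul_add, ih]
    push_cast
    ring

theorem fifteen_mul_sum_Ioo_neg_pow_four (n : ℤ) (hn : 1 ≤ n) :
    15 * ∑ i ∈ Finset.Ioo (-n) n, (i : R) ^ 4 =
      n * (n - 1) * (2 * n - 1) * (3 * n ^ 2 - 3 * n - 1) := by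
  induction n, hn using Int.leInduction with
  | base => simp [show Finset.Ioo (-1 : ℤ) 1 = {0} from rfl]
  | succ n hn ih =>
    rw [sum_Ioo_neg_succ _ (by omega), mul_add, mul_add, ih]
    push_cast
    ring

end PowerSums

theorem coeff_seriesMoment_psiSeries {K : Type*} [Field K] (a k : ℕ) :
    PowerSeries.coeff k (seriesMoment a (psiSeries K)) =
      ∑ n ∈ Finset.Icc 1 ((k : ℤ) + 1) with triangular n = k,
        (-1) ^ (n - 1) * ∑ i ∈ Finset.Ioo (-n) n, (i : K) ^ a := by
  rw [seriesMoment, PowerSeries.coeff_mk, psiSeries, PowerSeries.coeff_mk, map_sum]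
  refine Finset.sum_congr rfl fun n _ => ?_
  rw [Finset.mul_sum, map_sum, Finset.mul_sum]
  simp only [laurentMoment_C_mul_T]

theorem oddMomentsVanish_psiSeries {K : Type*} [Field K] : OddMomentsVanish (psiSeries K) := by
  constructor <;> ext k <;> rw [coeff_seriesMoment_psiSeries, map_zero] <;>
    refine Finset.sum_eq_zero fun n hn => ?_ <;>
    simp only [Finset.mem_filter, Finset.mem_Icc] at hn <;>
    rw [sum_Ioo_neg_odd_pow n hn.1.1 (by decide), mul_zero]

/-- The zeroth moment of `psiSeries`, the cube of Euler's product modulo 11. -/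
noncomputable def psiMoment : PowerSeries (ZMod 11) := seriesMoment 0 (psiSeries (ZMod 11))

theorem psiMoment_ne_zero : psiMoment ≠ 0 := by
  intro h
  have h1 := congrArg (PowerSeries.coeff 0) h
  rw [psiMoment, coeff_seriesMoment_psiSeries,
    show (Finset.Icc (1 : ℤ) ((0 : ℕ) + 1)).filter (fun n => triangular n = (0 : ℕ)) = {1} from rfl]
    at h1
  simp at h1

theorem coeff_psiMoment (k : ℕ) : PowerSeries.coeff k psiMoment =
    ∑ n ∈ Finset.Icc 1 ((k : ℤ) + 1) with triangular n = k,
      (-1) ^ (n - 1) * (2 * (n : ZMod 11) - 1) := by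
  rw [psiMoment, coeff_seriesMoment_psiSeries]
  refine Finset.sum_congr rfl fun n hn => ?_
  simp only [Finset.mem_filter, Finset.mem_Icc] at hn
  rw [sum_Ioo_neg_pow_zero n hn.1.1]

theorem two_mul_natCast_eq_of_triangular_eq {R : Type*} [CommRing R] {n : ℤ} {k : ℕ}
    (h : triangular n = k) : (2 * k : R) = n * (n - 1) := by
  have := congrArg (Int.cast : ℤ → R) (two_mul_triangular n)
  rw [h] at this
  push_cast at this
  exact this

theorem seriesMoment_two_psiSeries :
    seriesMoment 2 (psiSeries (ZMod 11)) = 8 * qDeriv _ psiMoment := by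
  ext k
  rw [← map_ofNat PowerSeries.C 8, PowerSeries.coeff_C_mul, coeff_qDeriv,
    coeff_seriesMoment_psiSeries, coeff_psiMoment, Finset.mul_sum, Finset.mul_sum]
  refine Finset.sum_congr rfl fun n hn => ?_
  simp only [Finset.mem_filter, Finset.mem_Icc] at hn
  have h1 := two_mul_natCast_eq_of_triangular_eq (R := ZMod 11) hn.2
  have h2 := three_mul_sum_Ioo_neg_sq (R := ZMod 11) n hn.1.1
  set S := ∑ i ∈ Finset.Ioo (-n) n, (i : ZMod 11) ^ 2
  linear_combination (-1) ^ (n - 1) * (4 * h2 - 4 * (2 * n - 1) * h1 - S * zmod11_eleven)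

theorem seriesMoment_four_psiSeries : seriesMoment 4 (psiSeries (ZMod 11)) =
    3 * qDeriv _ (qDeriv _ psiMoment) + 5 * qDeriv _ psiMoment := by
  ext k
  rw [← map_ofNat PowerSeries.C 3, ← map_ofNat PowerSeries.C 5, map_add, PowerSeries.coeff_C_mul,
    PowerSeries.coeff_C_mul, coeff_qDeriv, coeff_qDeriv, coeff_seriesMoment_psiSeries,
    coeff_psiMoment, Finset.mul_sum, Finset.mul_sum, Finset.mul_sum, Finset.mul_sum,
    ← Finset.sum_add_distrib]
  refine Finset.sum_congr rfl fun n hn => ?_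
  simp only [Finset.mem_filter, Finset.mem_Icc] at hn
  have h1 := two_mul_natCast_eq_of_triangular_eq (R := ZMod 11) hn.2
  have h2 := fifteen_mul_sum_Ioo_neg_pow_four (R := ZMod 11) n hn.1.1
  set S := ∑ i ∈ Finset.Ioo (-n) n, (i : ZMod 11) ^ 4
  linear_combination (-1) ^ (n - 1) * (3 * h2 -
    3 * (2 * n - 1) * (3 * n * (n - 1) - 1 + 6 * k) * h1 -
    (4 * S - (2 * n - 1) * (3 * k ^ 2 - k)) * zmod11_eleven)

/-- The operator `a q d/dq + b` on power series. -/
noncomputable def affineOp (a b : ℤ) (f : PowerSeries (ZMod 11)) : PowerSeries (ZMod 11) :=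
  a * qDeriv _ f + b * f

theorem coeff_affineOp (a b : ℤ) (f : PowerSeries (ZMod 11)) (k : ℕ) :
    PowerSeries.coeff k (affineOp a b f) = (a * k + b) * PowerSeries.coeff k f := by
  rw [affineOp, ← map_intCast (PowerSeries.C (R := ZMod 11)) a,
    ← map_intCast (PowerSeries.C (R := ZMod 11)) b, map_add,
    PowerSeries.coeff_C_mul, PowerSeries.coeff_C_mul, coeff_qDeriv]
  ring

theorem coeff_iterate_affineOp (a b : ℤ) (f : PowerSeries (ZMod 11)) (m k : ℕ) :
    PowerSeries.coeff k ((affineOp a b)^[m] f) = (a * k + b) ^ m * PowerSeries.coeff k f := by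
  induction m with
  | zero => simp
  | succ m ih =>
    rw [Function.iterate_succ_apply', coeff_affineOp, ih]
    ring

theorem affineOp_mul_of_affineOp_eq {a b : ℤ} {x u : PowerSeries (ZMod 11)}
    (h : affineOp a b x = x * u) (f : PowerSeries (ZMod 11)) :
    affineOp a b (x * f) = x * (a * qDeriv _ f + u * f) := by
  rw [affineOp] at h ⊢
  rw [qDeriv_mul]
  linear_combination f * h

theorem affineOp_iterate_psiMoment : (affineOp 8 1)^[5] psiMoment = psiMoment := by
  ext k
  rw [coeff_iterate_affineOp, coeff_psiMoment, Finset.mul_sum]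
  refine Finset.sum_congr rfl fun n hn => ?_
  simp only [Finset.mem_filter, Finset.mem_Icc] at hn
  have h1 := two_mul_natCast_eq_of_triangular_eq (R := ZMod 11) hn.2
  have h2 : ((8 : ℤ) : ZMod 11) * k + (1 : ℤ) = (2 * n - 1) ^ 2 := by
    push_cast
    linear_combination 4 * h1
  have h3 : (2 * (n : ZMod 11) - 1) ^ 11 = 2 * n - 1 := ZMod.pow_card _
  rw [h2]
  linear_combination (-1) ^ (n - 1) * h3

theorem affineOp_iterate_pentagonalSeries :
    (affineOp 2 1)^[6] (PowerSeries.pentagonalSeries (ZMod 11)) =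
      affineOp 2 1 (PowerSeries.pentagonalSeries (ZMod 11)) := by
  ext k
  rw [coeff_iterate_affineOp, coeff_affineOp]
  by_cases hk : k ∈ Set.range pentagonal
  · obtain ⟨n, rfl⟩ := hk
    have h1 := congrArg (Int.cast : ℤ → ZMod 11) (two_mul_natCast_pentagonal n)
    push_cast at h1
    have h2 : ((2 : ℤ) : ZMod 11) * (pentagonal n : ℕ) + (1 : ℤ) = (6 * n - 1) ^ 2 := by
      push_cast
      linear_combination 12 * h1 - 2 * (pentagonal n) * zmod11_eleven
    have h3 : (6 * (n : ZMod 11) - 1) ^ 11 = 6 * n - 1 := ZMod.pow_card _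
    rw [h2]
    congr 1
    linear_combination (6 * (n : ZMod 11) - 1) * h3
  · rw [PowerSeries.coeff_pentagonalSeries_eq_zero _ hk, mul_zero, mul_zero]

end Laurent

section CharEleven

set_option linter.unusedSimpArgs false

variable {K A : Type*} [CommRing K] [CommRing A] [Algebra K A] {D : Derivation K A A}
  {P Q R E : A}

theorem derivation_ofNat (D : Derivation K A A) (n : ℕ) [n.AtLeastTwo] :
    D (ofNat(n) : A) = 0 :=
  Derivation.map_natCast D n

variable [CharP A 11]

/-- The derivative of the fourth generator, read off from a differential equation of order four for
the cube of Euler's product. -/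
theorem derivation_eq_of_iterate_eq_one (hP : D P = P ^ 2 - Q) (hQ : D Q = 4 * (P * Q - R))
    (hR : D R = 6 * (P * R - E)) (h : (fun f => 8 * D f + P * f)^[5] 1 = 1) :
    D E = 8 * (P * E) + 10 * (Q * R) + 4 := by
  have h1 : 8 * D (1) + P * (1) = P := by
    simp only [map_add, Derivation.leibniz, Derivation.leibniz_pow, Derivation.map_one_eq_zero,
      smul_eq_mul, nsmul_eq_mul, derivation_ofNat, hP, hQ, hR]
    clear * -
    grind
  have h2 : 8 * D (P) + P * (P) = 9 * P ^ 2 + 3 * Q := by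
    simp only [map_add, Derivation.leibniz, Derivation.leibniz_pow, Derivation.map_one_eq_zero,
      smul_eq_mul, nsmul_eq_mul, derivation_ofNat, hP, hQ, hR]
    clear * -
    grind
  have h3 : 8 * D (9 * P ^ 2 + 3 * Q) + P * (9 * P ^ 2 + 3 * Q) = 10 * P ^ 3 + 10 * (P * Q) + 3 *
    R := by
    simp only [map_add, Derivation.leibniz, Derivation.leibniz_pow, Derivation.map_one_eq_zero,
      smul_eq_mul, nsmul_eq_mul, derivation_ofNat, hP, hQ, hR]
    clear * -
    grind
  have h4 : 8 * D (10 * P ^ 3 + 10 * (P * Q) + 3 * R) + P * (10 * P ^ 3 + 10 * (P * Q) + 3 * R) =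
    8 * P ^ 4 + 5 * (P ^ 2 * Q) + 3 * (P * R) + 8 * Q ^ 2 + 10 * E := by
    simp only [map_add, Derivation.leibniz, Derivation.leibniz_pow, Derivation.map_one_eq_zero,
      smul_eq_mul, nsmul_eq_mul, derivation_ofNat, hP, hQ, hR]
    clear * -
    grind
  simp only [Function.iterate_succ_apply', Function.iterate_zero, id_eq, h1, h2, h3, h4] at h
  simp only [map_add, Derivation.leibniz, Derivation.leibniz_pow, Derivation.map_one_eq_zero,
      smul_eq_mul, nsmul_eq_mul, derivation_ofNat, hP, hQ, hR] at h
  clear * - h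
  grind

/-- An algebraic relation coming from the pentagonal number theorem. -/
theorem relation_of_iterate_eq (hP : D P = P ^ 2 - Q) (hQ : D Q = 4 * (P * Q - R))
    (hR : D R = 6 * (P * R - E)) (hE : D E = 8 * (P * E) + 10 * (Q * R) + 4)
    (h : (fun f => 2 * D f + P * f)^[6] 1 = P) :
    7 * P + Q ^ 3 + 8 * (Q * E) + 6 * R ^ 2 = 0 := by
  have h1 : 2 * D (1) + P * (1) = P := by
    simp only [map_add, Derivation.leibniz, Derivation.leibniz_pow, Derivation.map_one_eq_zero,
      smul_eq_mul, nsmul_eq_mul, derivation_ofNat, hP, hQ, hR, hE]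
    clear * -
    grind
  have h2 : 2 * D (P) + P * (P) = 3 * P ^ 2 + 9 * Q := by
    simp only [map_add, Derivation.leibniz, Derivation.leibniz_pow, Derivation.map_one_eq_zero,
      smul_eq_mul, nsmul_eq_mul, derivation_ofNat, hP, hQ, hR, hE]
    clear * -
    grind
  have h3 : 2 * D (3 * P ^ 2 + 9 * Q) + P * (3 * P ^ 2 + 9 * Q) = 4 * P ^ 3 + 3 * (P * Q) + 5 * R
    := by
    simp only [map_add, Derivation.leibniz, Derivation.leibniz_pow, Derivation.map_one_eq_zero,
      smul_eq_mul, nsmul_eq_mul, derivation_ofNat, hP, hQ, hR, hE]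
    clear * -
    grind
  have h4 : 2 * D (4 * P ^ 3 + 3 * (P * Q) + 5 * R) + P * (4 * P ^ 3 + 3 * (P * Q) + 5 * R) = 6 *
    P ^ 4 + 9 * (P ^ 2 * Q) + 8 * (P * R) + 5 * Q ^ 2 + 6 * E := by
    simp only [map_add, Derivation.leibniz, Derivation.leibniz_pow, Derivation.map_one_eq_zero,
      smul_eq_mul, nsmul_eq_mul, derivation_ofNat, hP, hQ, hR, hE]
    clear * -
    grind
  have h5 : 2 * D (6 * P ^ 4 + 9 * (P ^ 2 * Q) + 8 * (P * R) + 5 * Q ^ 2 + 6 * E) + P * (6 * P ^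
    4 + 9 * (P ^ 2 * Q) + 8 * (P * R) + 5 * Q ^ 2 + 6 * E) = 10 * P ^ 5 + 3 * (P ^ 3 * Q) + 4 *
    (P ^ 2 * R) + 5 * (P * Q ^ 2) + 6 * (P * E) + 2 * (Q * R) + 4 := by
    simp only [map_add, Derivation.leibniz, Derivation.leibniz_pow, Derivation.map_one_eq_zero,
      smul_eq_mul, nsmul_eq_mul, derivation_ofNat, hP, hQ, hR, hE]
    clear * -
    grind
  have h6 : 2 * D (10 * P ^ 5 + 3 * (P ^ 3 * Q) + 4 * (P ^ 2 * R) + 5 * (P * Q ^ 2) + 6 * (P * E)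
    + 2 * (Q * R) + 4) + P * (10 * P ^ 5 + 3 * (P ^ 3 * Q) + 4 * (P ^ 2 * R) + 5 * (P * Q ^ 2) +
    6 * (P * E) + 2 * (Q * R) + 4) = 8 * P + Q ^ 3 + 8 * (Q * E) + 6 * R ^ 2 := by
    simp only [map_add, Derivation.leibniz, Derivation.leibniz_pow, Derivation.map_one_eq_zero,
      smul_eq_mul, nsmul_eq_mul, derivation_ofNat, hP, hQ, hR, hE]
    clear * -
    grind
  simp only [Function.iterate_succ_apply', Function.iterate_zero, id_eq, h1, h2, h3, h4, h5,
    h6] at h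
  clear * - h
  grind

theorem generator_relations [IsDomain A] (hP : D P = P ^ 2 - Q) (hQ : D Q = 4 * (P * Q - R))
    (hR : D R = 6 * (P * R - E)) (hE : D E = 8 * (P * E) + 10 * (Q * R) + 4)
    (h : 7 * P + Q ^ 3 + 8 * (Q * E) + 6 * R ^ 2 = 0) (hR0 : R ≠ 0)
    (h0 : 2 * R ^ 2 + 3 * Q * (E + 3 * Q ^ 2) ≠ 0) : E = Q ^ 2 ∧ Q * R = 1 := by
  have h1 : 2 * (Q ^ 2 * R) + 3 * Q + 6 * (R * E) = 0 := by
    have h' := congrArg D h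
    simp only [map_zero, map_add, Derivation.leibniz, Derivation.leibniz_pow, smul_eq_mul,
      nsmul_eq_mul, derivation_ofNat, hP, hQ, hR, hE] at h'
    clear * - h h'
    grind
  have h2 : 3 * P * Q + R - Q ^ 2 * E - 3 * E ^ 2 = 0 := by
    have h' := congrArg D h1
    simp only [map_zero, map_add, Derivation.leibniz, Derivation.leibniz_pow, smul_eq_mul,
      nsmul_eq_mul, derivation_ofNat, hP, hQ, hR, hE] at h'
    clear * - h1 h'
    grind
  have h3 : (E - Q ^ 2) * (2 * R ^ 2 + 3 * Q * (E + 3 * Q ^ 2)) = 0 := by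
    clear * - h h1 h2
    grind
  have h4 : E = Q ^ 2 := sub_eq_zero.mp ((mul_eq_zero.mp h3).resolve_right h0)
  have h5 : R * (Q * R - 1) = 0 := by
    clear * - h h1 h2 h4
    grind
  exact ⟨h4, sub_eq_zero.mp ((mul_eq_zero.mp h5).resolve_left hR0)⟩

theorem iterate_seven_eq (hP : D P = P ^ 2 - Q) (hQ : D Q = 4 * (P * Q - R))
    (hR : D R = 6 * (P * R - E)) (hE : D E = 8 * (P * E) + 10 * (Q * R) + 4)
    (hEQ : E = Q ^ 2) (hQR : Q * R = 1) : (fun f => 2 * D f - P * f)^[7] 1 = -Q := by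
  have h1 : 2 * D (1) - P * (1) = 10 * P := by
    simp only [map_add, Derivation.leibniz, Derivation.leibniz_pow, Derivation.map_one_eq_zero,
      smul_eq_mul, nsmul_eq_mul, derivation_ofNat, hP, hQ, hR, hE]
    clear * -
    grind
  have h2 : 2 * D (10 * P) - P * (10 * P) = 10 * P ^ 2 + 2 * Q := by
    simp only [map_add, Derivation.leibniz, Derivation.leibniz_pow, Derivation.map_one_eq_zero,
      smul_eq_mul, nsmul_eq_mul, derivation_ofNat, hP, hQ, hR, hE]
    clear * -
    grind
  have h3 : 2 * D (10 * P ^ 2 + 2 * Q) - P * (10 * P ^ 2 + 2 * Q) = 8 * P ^ 3 + 7 * (P * Q) + 6 *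
    R := by
    simp only [map_add, Derivation.leibniz, Derivation.leibniz_pow, Derivation.map_one_eq_zero,
      smul_eq_mul, nsmul_eq_mul, derivation_ofNat, hP, hQ, hR, hE]
    clear * -
    grind
  have h4 : 2 * D (8 * P ^ 3 + 7 * (P * Q) + 6 * R) - P * (8 * P ^ 3 + 7 * (P * Q) + 6 * R) = 7 *
    P ^ 4 + 4 * (P ^ 2 * Q) + 10 * (P * R) + 8 * Q ^ 2 + 5 * E := by
    simp only [map_add, Derivation.leibniz, Derivation.leibniz_pow, Derivation.map_one_eq_zero,
      smul_eq_mul, nsmul_eq_mul, derivation_ofNat, hP, hQ, hR, hE]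
    clear * -
    grind
  have h5 : 2 * D (7 * P ^ 4 + 4 * (P ^ 2 * Q) + 10 * (P * R) + 8 * Q ^ 2 + 5 * E) - P * (7 * P ^
    4 + 4 * (P ^ 2 * Q) + 10 * (P * R) + 8 * Q ^ 2 + 5 * E) = 5 * P ^ 5 + 10 * (P ^ 3 * Q) + 10 *
    (P ^ 2 * R) + 5 * (P * Q ^ 2) + 10 * (P * E) + 7 * (Q * R) + 7 := by
    simp only [map_add, Derivation.leibniz, Derivation.leibniz_pow, Derivation.map_one_eq_zero,
      smul_eq_mul, nsmul_eq_mul, derivation_ofNat, hP, hQ, hR, hE]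
    clear * -
    grind
  have h6 : 2 * D (5 * P ^ 5 + 10 * (P ^ 3 * Q) + 10 * (P ^ 2 * R) + 5 * (P * Q ^ 2) + 10 * (P *
    E) + 7 * (Q * R) + 7) - P * (5 * P ^ 5 + 10 * (P ^ 3 * Q) + 10 * (P ^ 2 * R) + 5 * (P * Q ^
    2) + 10 * (P * E) + 7 * (Q * R) + 7) = P ^ 6 + 3 * (P ^ 4 * Q) + 4 * (P ^ 3 * R) + 3 * (P ^ 2
    * Q ^ 2) + 6 * (P ^ 2 * E) + 4 * (P * Q * R) + 7 * P + Q ^ 3 + 6 * (Q * E) + 10 * R ^ 2 := by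
    simp only [map_add, Derivation.leibniz, Derivation.leibniz_pow, Derivation.map_one_eq_zero,
      smul_eq_mul, nsmul_eq_mul, derivation_ofNat, hP, hQ, hR, hE]
    clear * -
    grind
  have h7 : 2 * D (P ^ 6 + 3 * (P ^ 4 * Q) + 4 * (P ^ 3 * R) + 3 * (P ^ 2 * Q ^ 2) +
      6 * (P ^ 2 * E) + 4 * (P * Q * R) + 7 * P + Q ^ 3 + 6 * (Q * E) + 10 * R ^ 2) -
      P * (P ^ 6 + 3 * (P ^ 4 * Q) + 4 * (P ^ 3 * R) + 3 * (P ^ 2 * Q ^ 2) +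
      6 * (P ^ 2 * E) + 4 * (P * Q * R) + 7 * P + Q ^ 3 + 6 * (Q * E) + 10 * R ^ 2) = -Q := by
    simp only [map_add, Derivation.leibniz, Derivation.leibniz_pow, Derivation.map_one_eq_zero,
      smul_eq_mul, nsmul_eq_mul, derivation_ofNat, hP, hQ, hR, hE]
    clear * - hEQ hQR
    grind
  simp only [Function.iterate_succ_apply', Function.iterate_zero, id_eq, h1, h2, h3, h4, h5, h6, h7]

theorem iterate_ten_eq_one (hP : D P = P ^ 2 - Q) (hQ : D Q = 4 * (P * Q - R))
    (hR : D R = 6 * (P * R - E)) (hE : D E = 8 * (P * E) + 10 * (Q * R) + 4)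
    (h : 7 * P + Q ^ 3 + 8 * (Q * E) + 6 * R ^ 2 = 0) (hEQ : E = Q ^ 2) (hQR : Q * R = 1) :
    (fun f => 2 * D f - P * f)^[10] 1 = 1 := by
  have h8 : 2 * D (-Q) - P * -Q = 4 * (P * Q) + 8 * R := by
    simp only [map_neg, hQ]
    clear * -
    grind
  have h9 : 2 * D (4 * (P * Q) + 8 * R) - P * (4 * (P * Q) + 8 * R) =
      3 * (P ^ 2 * Q) + P * R + 6 * Q ^ 2 := by
    simp only [map_add, Derivation.leibniz, Derivation.leibniz_pow, Derivation.map_one_eq_zero,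
      smul_eq_mul, nsmul_eq_mul, derivation_ofNat, hP, hQ, hR, hE]
    clear * - hEQ hQR
    grind
  have h10 : 2 * D (3 * (P ^ 2 * Q) + P * R + 6 * Q ^ 2) -
      P * (3 * (P ^ 2 * Q) + P * R + 6 * Q ^ 2) =
      1 := by
    simp only [map_add, Derivation.leibniz, Derivation.leibniz_pow, Derivation.map_one_eq_zero,
      smul_eq_mul, nsmul_eq_mul, derivation_ofNat, hP, hQ, hR, hE]
    clear * - h hEQ hQR
    grind
  rw [Function.iterate_add_apply _ 3 7, iterate_seven_eq hP hQ hR hE hEQ hQR]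
  simp only [Function.iterate_succ_apply', Function.iterate_zero, id_eq, h8, h9, h10]

end CharEleven

instance charPPowerSeriesZModEleven : CharP (PowerSeries (ZMod 11)) 11 :=
  charP_of_injective_ringHom PowerSeries.C_injective 11

/-- The logarithmic derivative of Euler's product modulo 11. -/
noncomputable def eulerLogDeriv : PowerSeries (ZMod 11) :=
  partitionSeries * qDeriv _ (PowerSeries.pentagonalSeries (ZMod 11))

theorem partitionSeries_mul_pentagonalSeries :
    partitionSeries * PowerSeries.pentagonalSeries (ZMod 11) = 1 :=
  powerSeriesMk_card_partition_mul_pentagonalSeries _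

theorem partitionSeries_ne_zero : partitionSeries ≠ 0 :=
  left_ne_zero_of_mul_eq_one partitionSeries_mul_pentagonalSeries

theorem qDeriv_pentagonalSeries : qDeriv _ (PowerSeries.pentagonalSeries (ZMod 11)) =
    PowerSeries.pentagonalSeries (ZMod 11) * eulerLogDeriv := by
  rw [eulerLogDeriv]
  linear_combination -qDeriv _ (PowerSeries.pentagonalSeries (ZMod 11)) *
    partitionSeries_mul_pentagonalSeries

theorem qDeriv_partitionSeries :
    qDeriv _ partitionSeries = -(partitionSeries * eulerLogDeriv) := by
  have h := congrArg (qDeriv _) partitionSeries_mul_pentagonalSeries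
  rw [qDeriv_mul, Derivation.map_one_eq_zero] at h
  rw [eulerLogDeriv]
  linear_combination partitionSeries * h -
    qDeriv _ partitionSeries * partitionSeries_mul_pentagonalSeries

theorem psiSeries_moment_equations :
    psiMoment * (6 * qDeriv _ partitionSeries) + 24 * qDeriv _ psiMoment * partitionSeries = 0 ∧
    psiMoment ^ 2 * seriesMoment 4 rankSeries +
      18 * psiMoment * (8 * qDeriv _ psiMoment) * (6 * qDeriv _ partitionSeries) +
      (3 * psiMoment * (3 * qDeriv _ (qDeriv _ psiMoment) + 5 * qDeriv _ psiMoment) +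
        18 * (8 * qDeriv _ psiMoment) ^ 2) * partitionSeries = 0 := by
  have hψ := oddMomentsVanish_psiSeries (K := ZMod 11)
  have h2 := congrArg (seriesMoment 2) psiSeries_pow_mul_rankSeries
  have h4 := congrArg (seriesMoment 4) psiSeries_pow_mul_rankSeries
  rw [seriesMoment_map_C (by norm_num)] at h2 h4
  simp only [hψ.seriesMoment_two_mul, hψ.seriesMoment_four_mul, seriesMoment_zero_mul,
    seriesMoment_two_psiSeries, seriesMoment_four_psiSeries, seriesMoment_zero_rankSeries,
    seriesMoment_two_rankSeries] at h2 h4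
  rw [← psiMoment] at h2 h4
  constructor
  · refine mul_left_cancel₀ (pow_ne_zero 2 psiMoment_ne_zero) ?_
    linear_combination h2
  · refine mul_left_cancel₀ psiMoment_ne_zero ?_
    linear_combination h4

theorem qDeriv_psiMoment : qDeriv _ psiMoment = 3 * (psiMoment * eulerLogDeriv) := by
  have h := psiSeries_moment_equations.1
  rw [qDeriv_partitionSeries] at h
  refine mul_left_cancel₀ partitionSeries_ne_zero ?_
  generalize qDeriv _ psiMoment = a at h ⊢
  generalize psiMoment = b, partitionSeries = c, eulerLogDeriv = d at h ⊢
  grind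

/-- A linear relation between the second and fourth moments of the rank modulo 11. -/
theorem rankMomentSeries_four_eq : rankMomentSeries 4 =
    rankMomentSeries 2 - qDeriv _ (rankMomentSeries 2) + 2 * partitionSeries *
      (qDeriv _ eulerLogDeriv + 5 * eulerLogDeriv ^ 2 - eulerLogDeriv) := by
  have h := psiSeries_moment_equations.2
  simp only [seriesMoment_four_rankSeries, qDeriv_psiMoment, qDeriv_mul, derivation_ofNat,
    qDeriv_partitionSeries] at h
  refine mul_left_cancel₀ (pow_ne_zero 2 psiMoment_ne_zero) ?_
  generalize qDeriv _ eulerLogDeriv = a, qDeriv _ (rankMomentSeries 2) = e at h ⊢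
  generalize rankMomentSeries 2 = f, rankMomentSeries 4 = g at h ⊢
  generalize psiMoment = b, partitionSeries = c, eulerLogDeriv = d at h ⊢
  grind

theorem iterate_affineOp_eq_mul {a b : ℤ} {x u : PowerSeries (ZMod 11)}
    (h : affineOp a b x = x * u) (m : ℕ) :
    (affineOp a b)^[m] x =
      x * (fun f => (a : PowerSeries (ZMod 11)) * qDeriv _ f + u * f)^[m] 1 := by
  induction m with
  | zero => simp
  | succ m ih =>
    rw [Function.iterate_succ_apply', Function.iterate_succ_apply', ih,
      affineOp_mul_of_affineOp_eq h]

theorem affineOp_psiMoment : affineOp 8 1 psiMoment = psiMoment * (1 + 2 * eulerLogDeriv) := by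
  rw [affineOp, qDeriv_psiMoment]
  push_cast
  generalize psiMoment = b, eulerLogDeriv = d
  grind

theorem affineOp_pentagonalSeries : affineOp 2 1 (PowerSeries.pentagonalSeries (ZMod 11)) =
    PowerSeries.pentagonalSeries (ZMod 11) * (1 + 2 * eulerLogDeriv) := by
  rw [affineOp, qDeriv_pentagonalSeries]
  push_cast
  ring

theorem affineOp_partitionSeries :
    affineOp 2 (-1) partitionSeries = partitionSeries * -(1 + 2 * eulerLogDeriv) := by
  rw [affineOp, qDeriv_partitionSeries]
  push_cast
  ring

/-- The normalised logarithmic derivative `1 + 2 v` of Euler's product; together with the three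
series obtained from it by differentiating, it generates the relevant ring of series. -/
noncomputable def genP : PowerSeries (ZMod 11) := 1 + 2 * eulerLogDeriv

/-- The first covariant derivative of `genP`. -/
noncomputable def genQ : PowerSeries (ZMod 11) := genP ^ 2 - qDeriv _ genP

/-- The second covariant derivative of `genP`. -/
noncomputable def genR : PowerSeries (ZMod 11) := genP * genQ - 3 * qDeriv _ genQ

/-- The third covariant derivative of `genP`. -/
noncomputable def genE : PowerSeries (ZMod 11) := genP * genR - 2 * qDeriv _ genR

theorem qDeriv_genP : qDeriv _ genP = genP ^ 2 - genQ := by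
  rw [genQ]
  ring

theorem qDeriv_genQ : qDeriv _ genQ = 4 * (genP * genQ - genR) := by
  rw [genR]
  grind

theorem qDeriv_genR : qDeriv _ genR = 6 * (genP * genR - genE) := by
  rw [genE]
  grind

theorem qDeriv_genE : qDeriv _ genE = 8 * (genP * genE) + 10 * (genQ * genR) + 4 := by
  refine derivation_eq_of_iterate_eq_one qDeriv_genP qDeriv_genQ qDeriv_genR ?_
  have h := iterate_affineOp_eq_mul affineOp_psiMoment 5
  rw [affineOp_iterate_psiMoment] at h
  push_cast at h
  exact (mul_eq_left₀ psiMoment_ne_zero).mp h.symm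

theorem genP_relation : 7 * genP + genQ ^ 3 + 8 * (genQ * genE) + 6 * genR ^ 2 = 0 := by
  refine relation_of_iterate_eq qDeriv_genP qDeriv_genQ qDeriv_genR qDeriv_genE ?_
  have h := iterate_affineOp_eq_mul affineOp_pentagonalSeries 6
  rw [affineOp_iterate_pentagonalSeries, affineOp_pentagonalSeries] at h
  push_cast at h
  exact (mul_left_cancel₀ (right_ne_zero_of_mul_eq_one partitionSeries_mul_pentagonalSeries) h).symm

theorem genE_eq_and_genQ_mul_genR : genE = genQ ^ 2 ∧ genQ * genR = 1 := by
  have hv : PowerSeries.constantCoeff eulerLogDeriv = 0 := by simp [eulerLogDeriv]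
  have hP : PowerSeries.constantCoeff genP = 1 := by simp [genP, hv]
  have hQ : PowerSeries.constantCoeff genQ = 1 := by simp [genQ, hP]
  have hR : PowerSeries.constantCoeff genR = 1 := by simp [genR, hP, hQ]
  have hE : PowerSeries.constantCoeff genE = 1 := by simp [genE, hP, hR]
  refine generator_relations qDeriv_genP qDeriv_genQ qDeriv_genR qDeriv_genE genP_relation ?_ ?_
  · intro h
    simp [h] at hR
  · intro h
    have h' := congrArg PowerSeries.constantCoeff h
    simp only [map_add, map_mul, map_pow, map_ofNat, map_zero, hQ, hR, hE] at h'
    revert h'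
    decide

theorem iterate_affineOp_partitionSeries (m : ℕ) : (affineOp 2 (-1))^[m] partitionSeries =
    partitionSeries * (fun f => 2 * qDeriv _ f - genP * f)^[m] 1 := by
  rw [iterate_affineOp_eq_mul affineOp_partitionSeries]
  push_cast
  simp only [neg_mul, ← sub_eq_add_neg, genP]

theorem iterate_seven_affineOp_partitionSeries :
    (affineOp 2 (-1))^[7] partitionSeries = -(partitionSeries * genQ) := by
  rw [iterate_affineOp_partitionSeries, iterate_seven_eq qDeriv_genP qDeriv_genQ qDeriv_genR
    qDeriv_genE genE_eq_and_genQ_mul_genR.1 genE_eq_and_genQ_mul_genR.2, mul_neg]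

/-- The generating function form of Ramanujan's congruence modulo 11. -/
theorem iterate_ten_affineOp_partitionSeries :
    (affineOp 2 (-1))^[10] partitionSeries = partitionSeries := by
  rw [iterate_affineOp_partitionSeries, iterate_ten_eq_one qDeriv_genP qDeriv_genQ qDeriv_genR
    qDeriv_genE genP_relation genE_eq_and_genQ_mul_genR.1 genE_eq_and_genQ_mul_genR.2, mul_one]

/-- **Ramanujan's congruence** modulo 11. -/
theorem card_partition_eq_zero {n : ℕ} (hn : (n : ZMod 11) = 6) :
    (Fintype.card n.Partition : ZMod 11) = 0 := by
  have h := congrArg (PowerSeries.coeff n) iterate_ten_affineOp_partitionSeries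
  rw [coeff_iterate_affineOp, partitionSeries, PowerSeries.coeff_mk, hn] at h
  rw [← h, show ((2 : ℤ) : ZMod 11) * 6 + (-1 : ℤ) = 0 by decide]
  simp

theorem rankMomentSeries_four_eq_affineOp : rankMomentSeries 4 =
    rankMomentSeries 2 - qDeriv _ (rankMomentSeries 2) +
      (5 * (affineOp 2 (-1))^[7] partitionSeries + 5 * partitionSeries +
        4 * qDeriv _ partitionSeries + 8 * qDeriv _ (qDeriv _ partitionSeries)) := by
  rw [rankMomentSeries_four_eq, iterate_seven_affineOp_partitionSeries, genQ, genP]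
  simp only [qDeriv_partitionSeries, map_neg, map_add, Derivation.map_one_eq_zero, qDeriv_mul,
    derivation_ofNat]
  generalize qDeriv _ eulerLogDeriv = a, qDeriv _ (rankMomentSeries 2) = e
  generalize rankMomentSeries 2 = f, partitionSeries = c, eulerLogDeriv = d
  grind

/-- The fourth moment of the rank modulo 11 in terms of the second moment and the number of
partitions. -/
theorem sum_partitionRank_pow_four (n : ℕ) :
    ∑ π : n.Partition, (partitionRank π : ZMod 11) ^ 4 =
      (1 - n) * ∑ π : n.Partition, (partitionRank π : ZMod 11) ^ 2 +
        (5 * (2 * n - 1) ^ 7 + 5 + 4 * n + 8 * n ^ 2) * (Fintype.card n.Partition : ZMod 11) := by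
  have h := congrArg (PowerSeries.coeff n) rankMomentSeries_four_eq_affineOp
  rw [← map_ofNat (PowerSeries.C (R := ZMod 11)) 5, ← map_ofNat (PowerSeries.C (R := ZMod 11)) 4,
    ← map_ofNat (PowerSeries.C (R := ZMod 11)) 8] at h
  simp only [map_add, map_sub, PowerSeries.coeff_C_mul, coeff_qDeriv, coeff_iterate_affineOp,
    partitionSeries, rankMomentSeries, PowerSeries.coeff_mk] at h
  push_cast at h
  linear_combination h

theorem map_neg_partitionRank (n : ℕ) :
    (Finset.univ : Finset n.Partition).val.map (fun π => -partitionRank π) =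
      (Finset.univ : Finset n.Partition).val.map partitionRank := by
  ext m
  rw [Multiset.count_map, Multiset.count_map, ← Finset.filter_val, ← Finset.filter_val,
    Finset.card_val, Finset.card_val]
  have h (π : n.Partition) : m = -partitionRank π ↔ partitionRank π = -m := by omega
  simp only [h, eq_comm (a := m) (b := partitionRank _)]
  exact card_partitionRank_eq_neg m n

theorem rankCount_neg (a r : ℤ) (n : ℕ) : rankCount (-a) r n = rankCount a r n := by
  have h := congrArg (fun s : Multiset ℤ => (s.filter fun x => x % r = a % r).card)
    (map_neg_partitionRank n)
  simp only [Multiset.filter_map, Multiset.card_map, ← Finset.filter_val, Finset.card_val,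
    Function.comp_def] at h
  rw [rankCount, rankCount, ← h]
  congr 1
  ext π
  simp only [Finset.mem_filter, Finset.mem_univ, true_and]
  constructor
  · intro hm
    have := Int.ModEq.neg (n := r) hm
    rwa [neg_neg] at this
  · intro hm
    have := Int.ModEq.neg (n := r) hm
    rwa [neg_neg] at this

theorem rankCount_congr {a b r : ℤ} (h : a ≡ b [ZMOD r]) (n : ℕ) :
    rankCount a r n = rankCount b r n := by
  rw [rankCount, rankCount, h]

/-- A sum over partitions of a function of the rank modulo 11, grouped by residue classes. -/
theorem sum_partitionRank_eq_sum_rankCount (f : ZMod 11 → ZMod 11) (n : ℕ) :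
    ∑ π : n.Partition, f (partitionRank π) =
      ∑ j : ZMod 11, f j * (rankCount (j.val : ℤ) 11 n : ZMod 11) := by
  rw [← Finset.sum_fiberwise Finset.univ (fun π : n.Partition => (partitionRank π : ZMod 11))]
  refine Finset.sum_congr rfl fun j _ => ?_
  rw [Finset.sum_congr rfl fun π hπ => by rw [(Finset.mem_filter.mp hπ).2], Finset.sum_const,
    nsmul_eq_mul, mul_comm, rankCount]
  congr 4
  ext π
  have h := ZMod.intCast_eq_intCast_iff (partitionRank π) j.val 11
  simpa [Int.ModEq] using h

/-- The sum over residue classes, folded by conjugation. -/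
theorem sum_partitionRank_of_even (f : ZMod 11 → ZMod 11) (hf : ∀ x, f (-x) = f x) (n : ℕ) :
    ∑ π : n.Partition, f (partitionRank π) =
      f 0 * (rankCount 0 11 n : ZMod 11) + 2 * (f 1 * (rankCount 1 11 n : ZMod 11) +
        f 2 * (rankCount 2 11 n : ZMod 11) + f 3 * (rankCount 3 11 n : ZMod 11) +
        f 4 * (rankCount 4 11 n : ZMod 11) + f 5 * (rankCount 5 11 n : ZMod 11)) := by
  have h (a b : ℤ) (hab : a ≡ -b [ZMOD 11]) : rankCount a 11 n = rankCount b 11 n := by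
    rw [rankCount_congr hab, rankCount_neg]
  rw [sum_partitionRank_eq_sum_rankCount]
  change ∑ j : Fin 11, f j * (rankCount ((j : ℕ) : ℤ) 11 n : ZMod 11) = _
  simp only [Fin.sum_univ_succ, Fin.sum_univ_zero]
  have h6 : f 6 = f 5 := (hf 5)
  have h7 : f 7 = f 4 := (hf 4)
  have h8 : f 8 = f 3 := (hf 3)
  have h9 : f 9 = f 2 := (hf 2)
  have h10 : f 10 = f 1 := (hf 1)
  change f 0 * (rankCount 0 11 n : ZMod 11) + (f 1 * (rankCount 1 11 n : ZMod 11) +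
    (f 2 * (rankCount 2 11 n : ZMod 11) + (f 3 * (rankCount 3 11 n : ZMod 11) +
    (f 4 * (rankCount 4 11 n : ZMod 11) + (f 5 * (rankCount 5 11 n : ZMod 11) +
    (f 6 * (rankCount 6 11 n : ZMod 11) + (f 7 * (rankCount 7 11 n : ZMod 11) +
    (f 8 * (rankCount 8 11 n : ZMod 11) + (f 9 * (rankCount 9 11 n : ZMod 11) +
    (f 10 * (rankCount 10 11 n : ZMod 11) + 0)))))))))) = _
  rw [h6, h7, h8, h9, h10, h 6 5 (by decide), h 7 4 (by decide), h 8 3 (by decide),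
    h 9 2 (by decide), h 10 1 (by decide)]
  ring

theorem card_partition_eq_sum_rankCount (n : ℕ) :
    (Fintype.card n.Partition : ZMod 11) =
      (rankCount 0 11 n : ZMod 11) + 2 * ((rankCount 1 11 n : ZMod 11) +
        (rankCount 2 11 n : ZMod 11) + (rankCount 3 11 n : ZMod 11) +
        (rankCount 4 11 n : ZMod 11) + (rankCount 5 11 n : ZMod 11)) := by
  have h := sum_partitionRank_of_even (fun _ => 1) (fun _ => rfl) n
  simpa using h

/-- The congruences for the rank moments at `m`, in terms of the residue classes `N k`. -/
theorem rankCount_relation (N : ℕ → ZMod 11) (m r : ℕ)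
    (hN : ∀ k : ℕ, N k = (rankCount k 11 m : ZMod 11)) (hr : (m : ZMod 11) = r) :
    ((r : ZMod 11) = 6 → N 0 + 2 * (N 1 + N 2 + N 3 + N 4 + N 5) = 0) ∧
      2 * (N 1 + 2 ^ 4 * N 2 + 3 ^ 4 * N 3 + 4 ^ 4 * N 4 + 5 ^ 4 * N 5) =
        (1 - r) * (2 * (N 1 + 2 ^ 2 * N 2 + 3 ^ 2 * N 3 + 4 ^ 2 * N 4 + 5 ^ 2 * N 5)) +
        (5 * (2 * r - 1) ^ 7 + 5 + 4 * r + 8 * r ^ 2) *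
          (N 0 + 2 * (N 1 + N 2 + N 3 + N 4 + N 5)) := by
  rw [← hr]
  simp only [hN, Nat.cast_zero, Nat.cast_one, Nat.cast_ofNat]
  refine ⟨fun h => ?_, ?_⟩
  · rw [← card_partition_eq_sum_rankCount, card_partition_eq_zero h]
  · have h4 := sum_partitionRank_of_even (· ^ 4) (fun x => by ring) m
    have h2 := sum_partitionRank_of_even (· ^ 2) (fun x => by ring) m
    have h := sum_partitionRank_pow_four m
    rw [h4, h2, card_partition_eq_sum_rankCount] at h
    linear_combination h

/-- A combination of the residue classes `N(k,11,m)` is divisible by 11 as soon as it follows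
from the congruences for the rank moments. -/
theorem sum_rankCount_modEq_zero {m n r : ℕ} (hm : m = 11 * n + r) (c₀ c₁ c₂ c₃ c₄ c₅ : ℤ) {x : ℤ}
    (hx : x = c₀ * (rankCount 0 11 m : ℤ) + c₁ * (rankCount 1 11 m : ℤ) +
      c₂ * (rankCount 2 11 m : ℤ) + c₃ * (rankCount 3 11 m : ℤ) +
      c₄ * (rankCount 4 11 m : ℤ) + c₅ * (rankCount 5 11 m : ℤ))
    (hc : ∀ N : ℕ → ZMod 11, ((r : ZMod 11) = 6 → N 0 + 2 * (N 1 + N 2 + N 3 + N 4 + N 5) = 0) →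
      2 * (N 1 + 2 ^ 4 * N 2 + 3 ^ 4 * N 3 + 4 ^ 4 * N 4 + 5 ^ 4 * N 5) =
        (1 - r) * (2 * (N 1 + 2 ^ 2 * N 2 + 3 ^ 2 * N 3 + 4 ^ 2 * N 4 + 5 ^ 2 * N 5)) +
        (5 * (2 * r - 1) ^ 7 + 5 + 4 * r + 8 * r ^ 2) *
          (N 0 + 2 * (N 1 + N 2 + N 3 + N 4 + N 5)) →
      c₀ * N 0 + c₁ * N 1 + c₂ * N 2 + c₃ * N 3 + c₄ * N 4 + c₅ * N 5 = 0) :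
    x ≡ 0 [ZMOD 11] := by
  refine (ZMod.intCast_eq_intCast_iff _ _ 11).mp ?_
  have hr : (m : ZMod 11) = r := by
    rw [hm]
    push_cast
    linear_combination (n : ZMod 11) * zmod11_eleven
  obtain ⟨N, hN⟩ : ∃ N : ℕ → ZMod 11, ∀ k : ℕ, N k = (rankCount k 11 m : ZMod 11) :=
    ⟨_, fun _ => rfl⟩
  have h := hc N (rankCount_relation N m r hN hr).1 (rankCount_relation N m r hN hr).2
  simp only [hN, Nat.cast_zero, Nat.cast_one, Nat.cast_ofNat] at h
  rw [hx]
  push_cast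
  exact h

/-- Atkin–Hussain linear rank congruences modulo 11. -/
theorem linear_rank_congruences_mod_eleven (n : ℕ) :
    ((rankCount 2 11 (11  *  n) : ℤ)  -  5 * (rankCount 3 11 (11  *  n) : ℤ)  -  2 * (rankCount 4 11 (11  *  n) : ℤ)  +  6 * (rankCount 5 11 (11  *  n) : ℤ) ≡ 0 [ZMOD 11])
    ∧ ((rankCount 1 11 (11  *  n  +  1) : ℤ)  -  6 * (rankCount 2 11 (11  *  n  +  1) : ℤ)  +  4 * (rankCount 3 11 (11  *  n  +  1) : ℤ)  +  3 * (rankCount 4 11 (11  *  n  +  1) : ℤ)  -  2 * (rankCount 5 11 (11  *  n  +  1) : ℤ) ≡ 0 [ZMOD 11])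
    ∧ ((rankCount 0 11 (11  *  n  +  2) : ℤ)  +  4 * (rankCount 2 11 (11  *  n  +  2) : ℤ)  -  6 * (rankCount 4 11 (11  *  n  +  2) : ℤ)  +  (rankCount 5 11 (11  *  n  +  2) : ℤ) ≡ 0 [ZMOD 11])
    ∧ ((rankCount 0 11 (11  *  n  +  3) : ℤ)  +  3 * (rankCount 1 11 (11  *  n  +  3) : ℤ)  -  (rankCount 2 11 (11  *  n  +  3) : ℤ)  +  2 * (rankCount 3 11 (11  *  n  +  3) : ℤ)  -  (rankCount 4 11 (11  *  n  +  3) : ℤ)  -  4 * (rankCount 5 11 (11  *  n  +  3) : ℤ) ≡ 0 [ZMOD 11])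
    ∧ ((rankCount 0 11 (11  *  n  +  4) : ℤ)  +  3 * (rankCount 1 11 (11  *  n  +  4) : ℤ)  -  2 * (rankCount 2 11 (11  *  n  +  4) : ℤ)  -  4 * (rankCount 3 11 (11  *  n  +  4) : ℤ)  +  (rankCount 4 11 (11  *  n  +  4) : ℤ)  +  (rankCount 5 11 (11  *  n  +  4) : ℤ) ≡ 0 [ZMOD 11])
    ∧ ((rankCount 0 11 (11  *  n  +  5) : ℤ)  -  5 * (rankCount 1 11 (11  *  n  +  5) : ℤ)  -  (rankCount 2 11 (11  *  n  +  5) : ℤ)  +  (rankCount 3 11 (11  *  n  +  5) : ℤ)  +  5 * (rankCount 4 11 (11  *  n  +  5) : ℤ)  -  (rankCount 5 11 (11  *  n  +  5) : ℤ) ≡ 0 [ZMOD 11])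
    ∧ ((rankCount 1 11 (11  *  n  +  6) : ℤ)  -  5 * (rankCount 2 11 (11  *  n  +  6) : ℤ)  -  (rankCount 3 11 (11  *  n  +  6) : ℤ)  +  (rankCount 4 11 (11  *  n  +  6) : ℤ)  +  4 * (rankCount 5 11 (11  *  n  +  6) : ℤ) ≡ 0 [ZMOD 11])
    ∧ ((rankCount 0 11 (11  *  n  +  7) : ℤ)  -  2 * (rankCount 1 11 (11  *  n  +  7) : ℤ)  -  2 * (rankCount 2 11 (11  *  n  +  7) : ℤ)  +  5 * (rankCount 3 11 (11  *  n  +  7) : ℤ)  +  2 * (rankCount 4 11 (11  *  n  +  7) : ℤ)  -  4 * (rankCount 5 11 (11  *  n  +  7) : ℤ) ≡ 0 [ZMOD 11])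
    ∧ ((rankCount 0 11 (11  *  n  +  8) : ℤ)  +  5 * (rankCount 1 11 (11  *  n  +  8) : ℤ)  +  2 * (rankCount 2 11 (11  *  n  +  8) : ℤ)  +  (rankCount 3 11 (11  *  n  +  8) : ℤ)  -  3 * (rankCount 4 11 (11  *  n  +  8) : ℤ)  -  6 * (rankCount 5 11 (11  *  n  +  8) : ℤ) ≡ 0 [ZMOD 11])
    ∧ ((rankCount 0 11 (11  *  n  +  9) : ℤ)  -  4 * (rankCount 1 11 (11  *  n  +  9) : ℤ)  +  3 * (rankCount 2 11 (11  *  n  +  9) : ℤ)  -  (rankCount 3 11 (11  *  n  +  9) : ℤ)  -  (rankCount 4 11 (11  *  n  +  9) : ℤ)  +  2 * (rankCount 5 11 (11  *  n  +  9) : ℤ) ≡ 0 [ZMOD 11])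
    ∧ ((rankCount 0 11 (11  *  n  +  10) : ℤ)  -  6 * (rankCount 1 11 (11  *  n  +  10) : ℤ)  +  (rankCount 4 11 (11  *  n  +  10) : ℤ)  +  4 * (rankCount 5 11 (11  *  n  +  10) : ℤ) ≡ 0 [ZMOD 11]) := by
  refine ⟨?_, ?_, ?_, ?_, ?_, ?_, ?_, ?_, ?_, ?_, ?_⟩
  · exact sum_rankCount_modEq_zero (m := 11 * n) (r := 0) rfl 0 0 1 (-5) (-2) 6 (by ring)
      (by push_cast; grind)
  · exact sum_rankCount_modEq_zero rfl 0 1 (-6) 4 3 (-2) (by ring) (by push_cast; grind)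
  · exact sum_rankCount_modEq_zero rfl 1 0 4 0 (-6) 1 (by ring) (by push_cast; grind)
  · exact sum_rankCount_modEq_zero rfl 1 3 (-1) 2 (-1) (-4) (by ring) (by push_cast; grind)
  · exact sum_rankCount_modEq_zero rfl 1 3 (-2) (-4) 1 1 (by ring) (by push_cast; grind)
  · exact sum_rankCount_modEq_zero rfl 1 (-5) (-1) 1 5 (-1) (by ring) (by push_cast; grind)
  · exact sum_rankCount_modEq_zero rfl 0 1 (-5) (-1) 1 4 (by ring) (by push_cast; grind)
  · exact sum_rankCount_modEq_zero rfl 1 (-2) (-2) 5 2 (-4) (by ring) (by push_cast; grind)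
  · exact sum_rankCount_modEq_zero rfl 1 5 2 1 (-3) (-6) (by ring) (by push_cast; grind)
  · exact sum_rankCount_modEq_zero rfl 1 (-4) 3 (-1) (-1) 2 (by ring) (by push_cast; grind)
  · exact sum_rankCount_modEq_zero rfl 1 (-6) 0 0 1 4 (by ring) (by push_cast; grind)
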